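/- Assume (A1), (A2), (A3) and the normalization ψ(ξ) = 1 for |ξ| = 1. For s ≥ 1 set ψ^s(ξ) = s·ψ(ψ^{-1}(1/s)ξ), ν^s(x) = s·ψ^{-1}(1/s)^{-d}·ν(x/ψ^{-1}(1/s)), ψ^{-1,s}(u) = ψ^{-1}(u/s)/ψ^{-1}(1/s), and p_t^s(x) = (2π)^{-d} ∫_{ℝ^d} e^{-iξ·x} e^{-tψ^s(ξ)} dξ. Then there exist T₁ ≥ t₀ and C ≥ 1 (independent of s) such that for all s ≥ 1, all t ≥ T₁/s, and all x ∈ ℝ^d \ {0}: C^{-1}·min(ψ^{-1,s}(1/t)^d, t·ν^s(x)) ≤ p_t^s(x) ≤ C·min(ψ^{-1,s}(1/t)^d, t·ν^s(x)). -/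

import Mathlib

open MeasureTheory Filter Real
open scoped RealInnerProductSpace

noncomputable section

/-- Pruitt's concentration function `K(r) = r⁻² ∫_{|z|<r} |z|² ν(|z|) dz`. -/
def K (d : ℕ) (ν : ℝ → ℝ) (r : ℝ) : ℝ :=
  (∫ z in Metric.ball (0 : EuclideanSpace ℝ (Fin d)) r, ‖z‖ ^ 2 * ν ‖z‖) / r ^ 2

/-- Pruitt's concentration function `h(r) = ∫ (|z|²/r² ∧ 1) ν(|z|) dz`. -/
def hfun (d : ℕ) (ν : ℝ → ℝ) (r : ℝ) : ℝ :=
  ∫ z : EuclideanSpace ℝ (Fin d), min (‖z‖ ^ 2 / r ^ 2) 1 * ν ‖z‖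

/-- The characteristic (Lévy–Khintchine) exponent `ψ(ξ) = ∫ (1 - cos⟪ξ,z⟫) ν(|z|) dz`. -/
def ψ (d : ℕ) (ν : ℝ → ℝ) (ξ : EuclideanSpace ℝ (Fin d)) : ℝ :=
  ∫ z : EuclideanSpace ℝ (Fin d), (1 - Real.cos ⟪ξ, z⟫) * ν ‖z‖

/-- The radial nondecreasing majorant `ψ*(r) = sup_{|z| ≤ r} ψ(z)`. -/
def ψstar (d : ℕ) (ν : ℝ → ℝ) (r : ℝ) : ℝ :=
  sSup {y : ℝ | ∃ z : EuclideanSpace ℝ (Fin d), ‖z‖ ≤ r ∧ ψ d ν z = y}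

/-- The generalized inverse `ψ⁻¹(u) = sup {r ≥ 0 : ψ*(r) = u}`. -/
def ψinv (d : ℕ) (ν : ℝ → ℝ) (u : ℝ) : ℝ :=
  sSup {r : ℝ | 0 ≤ r ∧ ψstar d ν r = u}

/-- Characteristic exponent `ψˢ(ξ) = s·ψ(ψ⁻¹(1/s)ξ)` of the rescaled process. -/
def ψs (d : ℕ) (ν : ℝ → ℝ) (s : ℝ) (ξ : EuclideanSpace ℝ (Fin d)) : ℝ :=
  s * ψ d ν (ψinv d ν (1 / s) • ξ)

/-- Lévy density `νˢ(x) = s·ψ⁻¹(1/s)^{-d}·ν(x/ψ⁻¹(1/s))` of the rescaled process. -/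
def νs (d : ℕ) (ν : ℝ → ℝ) (s : ℝ) (x : EuclideanSpace ℝ (Fin d)) : ℝ :=
  s / ψinv d ν (1 / s) ^ d * ν (‖x‖ / ψinv d ν (1 / s))

/-- `ψ^{-1,s}(u) = ψ⁻¹(u/s)/ψ⁻¹(1/s)`. -/
def ψinvs (d : ℕ) (ν : ℝ → ℝ) (s u : ℝ) : ℝ :=
  ψinv d ν (u / s) / ψinv d ν (1 / s)

/-- The stable constant `𝒜(d,α)`. -/
def Aconst (d : ℕ) (α : ℝ) : ℝ :=
  α * (2 : ℝ) ^ (α - 1) * Real.Gamma (((d : ℝ) + α) / 2) /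
    (Real.Gamma (1 - α / 2) * Real.pi ^ ((d : ℝ) / 2))

/-- Heat kernel of the rescaled process, via Fourier inversion. -/
def pts (d : ℕ) (ν : ℝ → ℝ) (s t : ℝ) (x : EuclideanSpace ℝ (Fin d)) : ℝ :=
  ((2 * Real.pi) ^ d)⁻¹ *
    ∫ ξ : EuclideanSpace ℝ (Fin d), Real.cos ⟪ξ, x⟫ * Real.exp (-(t * ψs d ν s ξ))

/-- Heat kernel of the isotropic α-stable process. -/
def ptα (d : ℕ) (α t : ℝ) (x : EuclideanSpace ℝ (Fin d)) : ℝ :=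
  ((2 * Real.pi) ^ d)⁻¹ *
    ∫ ξ : EuclideanSpace ℝ (Fin d), Real.cos ⟪ξ, x⟫ * Real.exp (-(t * ‖ξ‖ ^ α))

/-- Heat kernel of the original process, via Fourier inversion. -/
def pt (d : ℕ) (ν : ℝ → ℝ) (t : ℝ) (x : EuclideanSpace ℝ (Fin d)) : ℝ :=
  ((2 * Real.pi) ^ d)⁻¹ *
    ∫ ξ : EuclideanSpace ℝ (Fin d), Real.cos ⟪ξ, x⟫ * Real.exp (-(t * ψ d ν ξ))

section CosineTransform

variable {E : Type*} [NormedAddCommGroup E] [InnerProductSpace ℝ E] [FiniteDimensional ℝ E]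
  [MeasurableSpace E] [BorelSpace E]

/-- The cosine transform of a function on a Euclidean space. -/
def cosTransform (F : E → ℝ) (x : E) : ℝ :=
  ∫ ξ, Real.cos ⟪x, ξ⟫ * F ξ

theorem integrable_cos_inner_mul {F : E → ℝ} (hF : Integrable F) (x : E) :
    Integrable (fun ξ => Real.cos ⟪x, ξ⟫ * F ξ) := by
  refine hF.bdd_mul (c := 1) (Continuous.aestronglyMeasurable (by fun_prop)) ?_
  exact Eventually.of_forall fun ξ => by simpa using Real.abs_cos_le_one _

theorem abs_cosTransform_le {F : E → ℝ} (hF : Integrable F) (x : E) :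
    |cosTransform F x| ≤ ∫ ξ, |F ξ| := by
  refine (abs_integral_le_integral_abs).trans ?_
  refine integral_mono (integrable_cos_inner_mul hF x).abs hF.abs fun ξ => ?_
  simp only [abs_mul]
  exact mul_le_of_le_one_left (abs_nonneg _) (Real.abs_cos_le_one _)

theorem continuous_cosTransform {F : E → ℝ} (hF : Integrable F) :
    Continuous (cosTransform F) := by
  refine continuous_of_dominated (bound := fun ξ => |F ξ|)
    (fun x => (integrable_cos_inner_mul hF x).aestronglyMeasurable) (fun x => ?_) hF.abs ?_
  · refine Eventually.of_forall fun ξ => ?_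
    simp only [norm_mul, Real.norm_eq_abs]
    exact mul_le_of_le_one_left (abs_nonneg _) (Real.abs_cos_le_one _)
  · exact Eventually.of_forall fun ξ => by fun_prop

theorem integral_cosTransform_mul {n F : E → ℝ} (hn : Integrable n) (hF : Integrable F) :
    ∫ ξ, cosTransform n ξ * F ξ = ∫ z, n z * cosTransform F z := by
  simp only [cosTransform, ← integral_mul_const, ← integral_const_mul]
  rw [integral_integral_swap]
  · refine integral_congr_ae (Eventually.of_forall fun z => ?_)
    refine integral_congr_ae (Eventually.of_forall fun ξ => ?_)
    simp only [real_inner_comm]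
    ring
  · have := (hF.mul_prod hn)
    refine (this.bdd_mul (c := 1) (f := fun p : E × E => Real.cos ⟪p.1, p.2⟫)
      (Continuous.aestronglyMeasurable (by fun_prop)) ?_).congr ?_
    · exact Eventually.of_forall fun ξ => by simpa using Real.abs_cos_le_one _
    · refine Eventually.of_forall fun p => ?_
      simp only [Function.uncurry]
      ring

theorem integrable_cosTransform_mul {n F : E → ℝ} (hn : Integrable n) (hF : Integrable F) :
    Integrable (fun ξ => cosTransform n ξ * F ξ) :=
  hF.bdd_mul (continuous_cosTransform hn).aestronglyMeasurable
    (Eventually.of_forall fun ξ => abs_cosTransform_le hn ξ)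

theorem integrable_mul_cosTransform_sub {n F : E → ℝ} (hn : Integrable n) (hF : Integrable F)
    (x : E) : Integrable (fun z => n z * cosTransform F (x - z)) := by
  refine hn.mul_bdd (c := ∫ ξ, |F ξ|) ?_ ?_
  · exact ((continuous_cosTransform hF).comp (by fun_prop)).aestronglyMeasurable
  · exact Eventually.of_forall fun ξ => abs_cosTransform_le hF _

theorem integrable_mul_cosTransform_add {n F : E → ℝ} (hn : Integrable n) (hF : Integrable F)
    (x : E) : Integrable (fun z => n z * cosTransform F (x + z)) := by
  refine hn.mul_bdd (c := ∫ ξ, |F ξ|) ?_ ?_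
  · exact ((continuous_cosTransform hF).comp (by fun_prop)).aestronglyMeasurable
  · exact Eventually.of_forall fun ξ => abs_cosTransform_le hF _

/-- The cosine transform turns multiplication by the transform of an even function into
convolution. -/
theorem cosTransform_cosTransform_mul {n F : E → ℝ} (hn : Integrable n) (hF : Integrable F)
    (heven : ∀ z, n (-z) = n z) (x : E) :
    cosTransform (fun ξ => cosTransform n ξ * F ξ) x = ∫ z, n z * cosTransform F (x - z) := by
  have h1 : cosTransform (fun ξ => cosTransform n ξ * F ξ) x
      = ∫ ξ, cosTransform n ξ * (Real.cos ⟪x, ξ⟫ * F ξ) := by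
    unfold cosTransform
    congr 1; ext ξ; ring
  rw [h1, integral_cosTransform_mul hn (integrable_cos_inner_mul hF x)]
  have h2 : ∀ z, cosTransform (fun ξ => Real.cos ⟪x, ξ⟫ * F ξ) z
      = (cosTransform F (x - z) + cosTransform F (x + z)) / 2 := by
    intro z
    simp only [cosTransform]
    rw [← integral_add (integrable_cos_inner_mul hF _) (integrable_cos_inner_mul hF _),
      ← integral_div]
    congr 1; ext ξ
    rw [inner_sub_left, inner_add_left, Real.cos_sub, Real.cos_add]
    ring
  have h3 : ∫ z, n z * cosTransform F (x + z) = ∫ z, n z * cosTransform F (x - z) := by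
    rw [← integral_neg_eq_self]
    simp only [heven, sub_eq_add_neg]
  have h4 : ∀ z, n z * cosTransform (fun ξ => Real.cos ⟪x, ξ⟫ * F ξ) z
      = (n z * cosTransform F (x - z) + n z * cosTransform F (x + z)) / 2 := by
    intro z; rw [h2]; ring
  simp only [h4]
  rw [integral_div, integral_add (integrable_mul_cosTransform_sub hn hF x)
    (integrable_mul_cosTransform_add hn hF x), h3]
  ring

theorem integrable_gaussian {b : ℝ} (hb : 0 < b) :
    Integrable (fun ξ : E => Real.exp (-b * ‖ξ‖ ^ 2)) := by
  have h := (GaussianFourier.integrable_cexp_neg_mul_sq_norm_add (V := E) (b := (b : ℂ))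
    (by simpa using hb) 0 0).norm
  refine h.congr (Eventually.of_forall fun ξ => ?_)
  simp only [Complex.norm_exp]
  congr 1
  simp [← Complex.ofReal_pow]

theorem cosTransform_gaussian {b : ℝ} (hb : 0 < b) (x : E) :
    cosTransform (fun ξ : E => Real.exp (-b * ‖ξ‖ ^ 2)) x
      = (π / b) ^ (Module.finrank ℝ E / 2 : ℝ) * Real.exp (-(‖x‖ ^ 2 / (4 * b))) := by
  have h := GaussianFourier.integral_cexp_neg_mul_sq_norm_add (V := E) (b := (b : ℂ))
    (by simpa using hb) Complex.I x
  have hi := (GaussianFourier.integrable_cexp_neg_mul_sq_norm_add (V := E) (b := (b : ℂ))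
    (by simpa using hb) Complex.I x)
  have h' := congrArg Complex.re h
  have hre : (∫ v : E, Complex.exp (-(b : ℂ) * (‖v‖ : ℂ) ^ 2 + Complex.I * ((⟪x, v⟫ : ℝ) : ℂ))).re
      = ∫ v : E, (Complex.exp (-(b : ℂ) * (‖v‖ : ℂ) ^ 2 + Complex.I * ((⟪x, v⟫ : ℝ) : ℂ))).re :=
    (integral_re hi).symm
  rw [hre] at h'
  have hl : cosTransform (fun ξ : E => Real.exp (-b * ‖ξ‖ ^ 2)) x =
      ∫ v : E, (Complex.exp (-(b : ℂ) * (‖v‖ : ℂ) ^ 2 + Complex.I * ((⟪x, v⟫ : ℝ) : ℂ))).re := by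
    unfold cosTransform
    congr 1; ext v
    rw [Complex.exp_re]
    simp [← Complex.ofReal_pow]
    ring
  rw [hl, h']
  have hr : ((π / b : ℂ) ^ (Module.finrank ℝ E / 2 : ℂ) *
      Complex.exp (Complex.I ^ 2 * (‖x‖ : ℂ) ^ 2 / (4 * b)))
      = (((π / b) ^ (Module.finrank ℝ E / 2 : ℝ) * Real.exp (-(‖x‖ ^ 2 / (4 * b))) : ℝ) : ℂ) := by
    push_cast [Complex.ofReal_cpow (by positivity : (0 : ℝ) ≤ π / b)]
    congr 2
    rw [Complex.I_sq]; ring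
  rw [hr, Complex.ofReal_re]

theorem integral_gaussian_mul_cosTransform {F : E → ℝ} (hF : Integrable F) {b : ℝ} (hb : 0 < b) :
    ∫ y, Real.exp (-b * ‖y‖ ^ 2) * cosTransform F y
      = (π / b) ^ (Module.finrank ℝ E / 2 : ℝ) * ∫ ξ, Real.exp (-(‖ξ‖ ^ 2 / (4 * b))) * F ξ := by
  rw [← integral_cosTransform_mul (integrable_gaussian hb) hF]
  simp only [cosTransform_gaussian hb, mul_assoc]
  rw [integral_const_mul]

end CosineTransform

section Unimodality

/-- A function is radially antitone if it is a non-increasing function of the norm. -/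
def RadiallyAntitone {E : Type*} [NormedAddCommGroup E] (f : E → ℝ) : Prop :=
  ∀ ⦃x y : E⦄, ‖x‖ ≤ ‖y‖ → f y ≤ f x

theorem RadiallyAntitone.eq_of_norm_eq {E : Type*} [NormedAddCommGroup E] {f : E → ℝ}
    (hf : RadiallyAntitone f) {x y : E}
    (h : ‖x‖ = ‖y‖) : f x = f y :=
  le_antisymm (hf h.ge) (hf h.le)

variable {E : Type*} [NormedAddCommGroup E] [InnerProductSpace ℝ E] [FiniteDimensional ℝ E]
  [MeasurableSpace E] [BorelSpace E]

/-- The convolution of two radially antitone functions is radially antitone. -/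
theorem RadiallyAntitone.convolution {f g : E → ℝ} (hf : RadiallyAntitone f)
    (hg : RadiallyAntitone g) (hfg : ∀ x, Integrable (fun y => g y * f (x - y))) :
    RadiallyAntitone (fun x => ∫ y, g y * f (x - y)) := by
  intro x x' hxx
  rcases eq_or_ne x x' with rfl | hne
  · exact le_rfl
  obtain ⟨v, hv⟩ : ∃ v, v = x' - x := ⟨_, rfl⟩
  have hv0 : v ≠ 0 := hv ▸ sub_ne_zero.mpr hne.symm
  have hvn : 0 < ‖v‖ ^ 2 := by positivity
  set ρ := (Submodule.span ℝ {v})ᗮ.reflection with hρ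
  have hρapp : ∀ w, ρ w = w - (2 * ⟪v, w⟫ / ‖v‖ ^ 2) • v := by
    intro w
    rw [hρ, Submodule.reflection_orthogonal_apply, Submodule.reflection_singleton_apply]
    simp only [RCLike.ofReal_real_eq_id, id]
    module
  have hρv : ρ v = -v := Submodule.reflection_orthogonalComplement_singleton_eq_neg v
  let σ : E → E := fun y => ρ (y - x) + x'
  have hσmp : MeasurePreserving σ := by
    have h1 : MeasurePreserving (fun y : E => y - x) := measurePreserving_sub_right volume x
    have h2 : MeasurePreserving (fun y : E => ρ y) := ρ.measurePreserving
    have h3 : MeasurePreserving (fun y : E => y + x') := measurePreserving_add_right volume x'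
    exact h3.comp (h2.comp h1)
  have hσe : MeasurableEmbedding σ := by
    have h1 := (Homeomorph.subRight x).measurableEmbedding
    have h2 := ρ.toHomeomorph.measurableEmbedding
    have h3 := (Homeomorph.addRight x').measurableEmbedding
    exact h3.comp (h2.comp h1)
  have hσ1 : ∀ y, ‖x - σ y‖ = ‖x' - y‖ := by
    intro y
    have : x - σ y = ρ (x' - y) := by
      have : x' - y = v - (y - x) := by rw [hv]; abel
      rw [this, map_sub, hρv]
      simp only [σ, hv]; abel
    rw [this, LinearIsometryEquiv.norm_map]
  have hσ2 : ∀ y, ‖x' - σ y‖ = ‖x - y‖ := by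
    intro y
    have : x' - σ y = ρ (x - y) := by
      have : x - y = -(y - x) := by abel
      rw [this, map_neg]
      simp only [σ]; abel
    rw [this, LinearIsometryEquiv.norm_map]
  have hkey : ∀ y, (‖σ y‖ ^ 2 - ‖y‖ ^ 2) * ‖v‖ ^ 2
      = (‖x' - y‖ ^ 2 - ‖x - y‖ ^ 2) * (‖x'‖ ^ 2 - ‖x‖ ^ 2) := by
    intro y
    obtain ⟨c, hc⟩ : ∃ c, c = 2 * ⟪v, y - x⟫ / ‖v‖ ^ 2 := ⟨_, rfl⟩
    have hcv : c * ‖v‖ ^ 2 = 2 * ⟪v, y - x⟫ := by rw [hc]; field_simp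
    have e1 : σ y = y + (1 - c) • v := by
      simp only [σ, hρapp]
      rw [← hc, hv]
      module
    have e2 : x' - y = v - (y - x) := by rw [hv]; abel
    have e3 : x - y = - (y - x) := by abel
    have e4 : x' = x + v := by rw [hv]; abel
    have e5 : ⟪v, y - x⟫ = ⟪v, y⟫ - ⟪v, x⟫ := inner_sub_right _ _ _
    rw [e2, e3, norm_neg, e1, norm_add_sq_real, norm_sub_sq_real v, norm_smul, inner_smul_right,
      mul_pow, Real.norm_eq_abs, sq_abs, e4, norm_add_sq_real x v]
    rw [real_inner_comm v y, real_inner_comm v x]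
    generalize ‖v‖ ^ 2 = V at *
    generalize (⟪v, y⟫ : ℝ) = a at *
    generalize (⟪v, x⟫ : ℝ) = b at *
    rw [e5] at hcv ⊢
    linear_combination (c * V + 2 * (a - b) - 2 * V - 2 * a) * hcv
  have hx2 : 0 ≤ ‖x'‖ ^ 2 - ‖x‖ ^ 2 := by
    have := pow_le_pow_left₀ (norm_nonneg x) hxx 2
    linarith
  have hpos : ∀ y, 0 ≤ (g y - g (σ y)) * (f (x - y) - f (x' - y)) := by
    intro y
    rcases le_total ‖x - y‖ ‖x' - y‖ with h | h
    · have h1 := hf h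
      have h2 : ‖y‖ ≤ ‖σ y‖ := by
        have h3 : 0 ≤ ‖x' - y‖ ^ 2 - ‖x - y‖ ^ 2 := by
          have := pow_le_pow_left₀ (norm_nonneg _) h 2
          linarith
        have h4 : 0 ≤ (‖σ y‖ ^ 2 - ‖y‖ ^ 2) * ‖v‖ ^ 2 := by
          rw [hkey]; exact mul_nonneg h3 hx2
        exact le_of_sq_le_sq (by linarith [nonneg_of_mul_nonneg_left h4 hvn]) (norm_nonneg _)
      exact mul_nonneg (sub_nonneg.mpr (hg h2)) (sub_nonneg.mpr h1)
    · have h1 := hf h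
      have h2 : ‖σ y‖ ≤ ‖y‖ := by
        have h3 : ‖x' - y‖ ^ 2 - ‖x - y‖ ^ 2 ≤ 0 := by
          have := pow_le_pow_left₀ (norm_nonneg _) h 2
          linarith
        have h4 : 0 ≤ (‖y‖ ^ 2 - ‖σ y‖ ^ 2) * ‖v‖ ^ 2 := by
          have := hkey y
          nlinarith [mul_nonneg (neg_nonneg.mpr h3) hx2]
        exact le_of_sq_le_sq (by linarith [nonneg_of_mul_nonneg_left h4 hvn]) (norm_nonneg _)
      exact mul_nonneg_of_nonpos_of_nonpos (sub_nonpos.mpr (hg h2)) (sub_nonpos.mpr h1)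
  have hi : Integrable (fun y => g y * (f (x - y) - f (x' - y))) := by
    simp only [mul_sub]
    exact (hfg x).sub (hfg x')
  have hσi : Integrable (fun y => g (σ y) * (f (x - σ y) - f (x' - σ y))) :=
    (hσmp.integrable_comp_emb hσe).mpr hi
  have hσint : ∫ y, g (σ y) * (f (x - σ y) - f (x' - σ y))
      = ∫ y, g y * (f (x - y) - f (x' - y)) := hσmp.integral_comp hσe
        (fun y => g y * (f (x - y) - f (x' - y)))
  have hsum : 0 ≤ ∫ y, (g y * (f (x - y) - f (x' - y))
      + g (σ y) * (f (x - σ y) - f (x' - σ y))) := by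
    refine integral_nonneg fun y => ?_
    have := hpos y
    simp only [hf.eq_of_norm_eq (hσ1 y), hf.eq_of_norm_eq (hσ2 y), Pi.zero_apply]
    linarith
  rw [integral_add hi hσi, hσint] at hsum
  have hfin : ∫ y, g y * (f (x - y) - f (x' - y))
      = (∫ y, g y * f (x - y)) - ∫ y, g y * f (x' - y) := by
    simp only [mul_sub]
    exact integral_sub (hfg x) (hfg x')
  linarith

end Unimodality

/-- A family of continuous functions bounded in absolute value by `2`. -/
def BoundedFamily {E : Type*} [TopologicalSpace E] (A : Set (E → ℝ)) : Prop :=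
  ∀ κ ∈ A, Continuous κ ∧ ∀ ξ, |κ ξ| ≤ 2

/-- The kernels testing nonnegativity of the cosine transform. -/
def positivityKernels (E : Type*) [NormedAddCommGroup E] [InnerProductSpace ℝ E] : Set (E → ℝ) :=
  {κ | ∃ x : E, κ = fun ξ => Real.cos ⟪x, ξ⟫}

/-- The kernels testing radial monotonicity of the cosine transform. -/
def unimodalityKernels (E : Type*) [NormedAddCommGroup E] [InnerProductSpace ℝ E] : Set (E → ℝ) :=
  {κ | ∃ x y : E, ‖x‖ ≤ ‖y‖ ∧ κ = fun ξ => Real.cos ⟪x, ξ⟫ - Real.cos ⟪y, ξ⟫}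

theorem boundedFamily_positivityKernels {E : Type*} [NormedAddCommGroup E]
    [InnerProductSpace ℝ E] : BoundedFamily (positivityKernels E) := by
  rintro κ ⟨x, rfl⟩
  refine ⟨by fun_prop, fun ξ => ?_⟩
  linarith [Real.abs_cos_le_one ⟪x, ξ⟫]

theorem boundedFamily_unimodalityKernels {E : Type*} [NormedAddCommGroup E]
    [InnerProductSpace ℝ E] : BoundedFamily (unimodalityKernels E) := by
  rintro κ ⟨x, y, -, rfl⟩
  refine ⟨by fun_prop, fun ξ => ?_⟩
  refine (abs_sub _ _).trans ?_
  linarith [Real.abs_cos_le_one ⟪x, ξ⟫, Real.abs_cos_le_one ⟪y, ξ⟫]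


section DualCone

variable {E : Type*} [NormedAddCommGroup E] [InnerProductSpace ℝ E] [FiniteDimensional ℝ E]
  [MeasurableSpace E] [BorelSpace E]

/-- The cone of integrable functions whose pairing with each member of `A` is nonnegative. -/
def dualCone (A : Set (E → ℝ)) : Set (E → ℝ) :=
  {F | Integrable F ∧ ∀ κ ∈ A, 0 ≤ ∫ ξ, κ ξ * F ξ}

variable {A : Set (E → ℝ)}

theorem BoundedFamily.integrable_mul (hA : BoundedFamily A) {κ F : E → ℝ} (hκ : κ ∈ A)
    (hF : Integrable F) : Integrable (fun ξ => κ ξ * F ξ) :=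
  hF.bdd_mul (hA κ hκ).1.aestronglyMeasurable (Eventually.of_forall (hA κ hκ).2)

theorem dualCone_add (hA : BoundedFamily A) {F G : E → ℝ} (hF : F ∈ dualCone A)
    (hG : G ∈ dualCone A) : (fun ξ => F ξ + G ξ) ∈ dualCone A := by
  refine ⟨hF.1.add hG.1, fun κ hκ => ?_⟩
  simp only [mul_add]
  rw [integral_add (hA.integrable_mul hκ hF.1) (hA.integrable_mul hκ hG.1)]
  exact add_nonneg (hF.2 κ hκ) (hG.2 κ hκ)

theorem dualCone_const_mul {F : E → ℝ} (hF : F ∈ dualCone A) {c : ℝ} (hc : 0 ≤ c) :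
    (fun ξ => c * F ξ) ∈ dualCone A := by
  refine ⟨hF.1.const_mul c, fun κ hκ => ?_⟩
  simp only [mul_left_comm _ c]
  rw [integral_const_mul]
  exact mul_nonneg hc (hF.2 κ hκ)

theorem dualCone_zero : (fun _ => 0) ∈ dualCone A :=
  ⟨integrable_zero _ _ _, fun κ _ => by simp⟩

theorem dualCone_sum (hA : BoundedFamily A) {ι : Type*} (s : Finset ι) {F : ι → E → ℝ}
    (hF : ∀ i ∈ s, F i ∈ dualCone A) : (fun ξ => ∑ i ∈ s, F i ξ) ∈ dualCone A := by
  classical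
  induction s using Finset.induction_on with
  | empty => simpa using dualCone_zero
  | insert a s ha ih =>
    simp only [Finset.sum_insert ha]
    exact dualCone_add hA (hF a (Finset.mem_insert_self a s))
      (ih fun i hi => hF i (Finset.mem_insert_of_mem hi))

theorem dualCone_of_tendsto (hA : BoundedFamily A) {F : ℕ → E → ℝ} {F' G : E → ℝ}
    (hF : ∀ n, F n ∈ dualCone A) (hG : Integrable G) (hFG : ∀ n ξ, |F n ξ| ≤ G ξ)
    (hlim : ∀ ξ, Tendsto (fun n => F n ξ) atTop (nhds (F' ξ))) : F' ∈ dualCone A := by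
  have hmeas : AEStronglyMeasurable F' :=
    aestronglyMeasurable_of_tendsto_ae atTop (fun n => (hF n).1.aestronglyMeasurable)
      (Eventually.of_forall hlim)
  have hbd : ∀ ξ, |F' ξ| ≤ G ξ := fun ξ =>
    le_of_tendsto ((continuous_abs.tendsto _).comp (hlim ξ)) (Eventually.of_forall fun n => hFG n ξ)
  refine ⟨hG.mono' hmeas (Eventually.of_forall hbd), fun κ hκ => ?_⟩
  have h : Tendsto (fun n => ∫ ξ, κ ξ * F n ξ) atTop (nhds (∫ ξ, κ ξ * F' ξ)) := by
    refine tendsto_integral_of_dominated_convergence (fun ξ => 2 * G ξ)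
      (fun n => (hA.integrable_mul hκ (hF n).1).aestronglyMeasurable) (hG.const_mul 2)
      (fun n => Eventually.of_forall fun ξ => ?_)
      (Eventually.of_forall fun ξ => (hlim ξ).const_mul _)
    rw [norm_mul]
    exact mul_le_mul ((hA κ hκ).2 ξ) (hFG n ξ) (norm_nonneg _) (by norm_num)
  exact ge_of_tendsto' h fun n => (hF n).2 κ hκ

/-- If multiplication by `Q` preserves the cone, then so does multiplication by
`exp (T Q) - T Q`. -/
theorem dualCone_exp_sub_mul (hA : BoundedFamily A) {Q : E → ℝ} {B : ℝ} (hQ : ∀ ξ, |Q ξ| ≤ B)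
    (hmul : ∀ F ∈ dualCone A, (fun ξ => Q ξ * F ξ) ∈ dualCone A) {F : E → ℝ}
    (hF : F ∈ dualCone A) {T : ℝ} (hT : 0 ≤ T) :
    (fun ξ => (Real.exp (T * Q ξ) - T * Q ξ) * F ξ) ∈ dualCone A := by
  have hpow : ∀ n : ℕ, (fun ξ => Q ξ ^ n * F ξ) ∈ dualCone A := by
    intro n
    induction n with
    | zero => simpa using hF
    | succ n ih =>
      have := hmul _ ih
      simpa only [pow_succ', mul_assoc] using this
  have hterm : ∀ n : ℕ, (fun ξ => (T * Q ξ) ^ n / n.factorial * F ξ) ∈ dualCone A := by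
    intro n
    have := dualCone_const_mul (hpow n) (c := T ^ n / n.factorial) (by positivity)
    refine (congrArg (· ∈ dualCone A) ?_).mp this
    ext ξ
    rw [mul_pow]; ring
  let s : ℕ → Finset ℕ := fun N => (Finset.range (N + 2)).erase 1
  have hs : ∀ N (f : ℕ → ℝ), ∑ n ∈ s N, f n = (∑ n ∈ Finset.range (N + 2), f n) - f 1 := by
    intro N f
    rw [Finset.sum_erase_eq_sub (by simp)]
  refine dualCone_of_tendsto hA (F := fun N ξ => ∑ n ∈ s N, (T * Q ξ) ^ n / n.factorial * F ξ)
    (G := fun ξ => Real.exp (T * B) * |F ξ|)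
    (fun N => dualCone_sum hA _ fun n _ => hterm n) (hF.1.abs.const_mul _) ?_ ?_
  · intro N ξ
    rw [← Finset.sum_mul, abs_mul]
    refine mul_le_mul_of_nonneg_right ?_ (abs_nonneg _)
    have hB : |T * Q ξ| ≤ T * B := by
      rw [abs_mul, abs_of_nonneg hT]; exact mul_le_mul_of_nonneg_left (hQ ξ) hT
    calc |∑ n ∈ s N, (T * Q ξ) ^ n / n.factorial|
        ≤ ∑ n ∈ s N, |(T * Q ξ) ^ n / n.factorial| := Finset.abs_sum_le_sum_abs _ _
      _ ≤ ∑ n ∈ Finset.range (N + 2), |(T * Q ξ) ^ n / n.factorial| :=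
          Finset.sum_le_sum_of_subset_of_nonneg (Finset.erase_subset _ _)
            fun _ _ _ => abs_nonneg _
      _ ≤ ∑ n ∈ Finset.range (N + 2), (T * B) ^ n / n.factorial := by
          refine Finset.sum_le_sum fun n _ => ?_
          rw [abs_div, abs_pow, Nat.abs_cast]
          gcongr
      _ ≤ Real.exp (T * B) := Real.sum_le_exp_of_nonneg ((abs_nonneg _).trans hB) _
  · intro ξ
    simp only [hs, ← Finset.sum_mul]
    have h1 : Tendsto (fun N => ∑ n ∈ Finset.range N, (T * Q ξ) ^ n / n.factorial) atTop
        (nhds (Real.exp (T * Q ξ))) := by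
      rw [Real.exp_eq_exp_ℝ]
      exact (NormedSpace.expSeries_div_hasSum_exp (T * Q ξ)).tendsto_sum_nat
    have h2 := (h1.comp (tendsto_add_atTop_nat 2)).sub_const (T * Q ξ)
    have h3 := h2.mul_const (F ξ)
    refine h3.congr fun N => ?_
    simp only [Function.comp]
    simp
    ring

theorem dualCone_exp_mul (hA : BoundedFamily A) {Q : E → ℝ} {B : ℝ} (hQ : ∀ ξ, |Q ξ| ≤ B)
    (hmul : ∀ F ∈ dualCone A, (fun ξ => Q ξ * F ξ) ∈ dualCone A) {F : E → ℝ}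
    (hF : F ∈ dualCone A) {T : ℝ} (hT : 0 ≤ T) :
    (fun ξ => Real.exp (T * Q ξ) * F ξ) ∈ dualCone A := by
  have := dualCone_add hA (dualCone_exp_sub_mul hA hQ hmul hF hT)
    (dualCone_const_mul (hmul F hF) hT)
  refine (congrArg (· ∈ dualCone A) ?_).mp this
  ext ξ; ring

theorem mem_dualCone_positivityKernels {F : E → ℝ} :
    F ∈ dualCone (positivityKernels E) ↔ Integrable F ∧ ∀ x, 0 ≤ cosTransform F x := by
  refine and_congr_right fun hF => ⟨fun h x => h _ ⟨x, rfl⟩, ?_⟩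
  rintro h κ ⟨x, rfl⟩
  exact h x

theorem mem_dualCone_unimodalityKernels {F : E → ℝ} :
    F ∈ dualCone (unimodalityKernels E) ↔ Integrable F ∧ RadiallyAntitone (cosTransform F) := by
  refine and_congr_right fun hF => ?_
  have key : ∀ x y, ∫ ξ, (Real.cos ⟪x, ξ⟫ - Real.cos ⟪y, ξ⟫) * F ξ
      = cosTransform F x - cosTransform F y := by
    intro x y
    simp only [sub_mul]
    exact integral_sub (integrable_cos_inner_mul hF x) (integrable_cos_inner_mul hF y)
  constructor
  · intro h x y hxy
    have := h _ ⟨x, y, hxy, rfl⟩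
    rw [key] at this
    linarith
  · rintro h κ ⟨x, y, hxy, rfl⟩
    rw [key]
    linarith [h hxy]

theorem cosTransform_mul_mem_positivity {n F : E → ℝ} (hn : Integrable n)
    (heven : ∀ z, n (-z) = n z) (hn0 : ∀ z, 0 ≤ n z)
    (hF : F ∈ dualCone (positivityKernels E)) :
    (fun ξ => cosTransform n ξ * F ξ) ∈ dualCone (positivityKernels E) := by
  rw [mem_dualCone_positivityKernels] at hF ⊢
  refine ⟨integrable_cosTransform_mul hn hF.1, fun x => ?_⟩
  rw [cosTransform_cosTransform_mul hn hF.1 heven]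
  exact integral_nonneg fun z => mul_nonneg (hn0 z) (hF.2 _)

theorem cosTransform_mul_mem_unimodality {n F : E → ℝ} (hn : Integrable n)
    (hanti : RadiallyAntitone n) (hF : F ∈ dualCone (unimodalityKernels E)) :
    (fun ξ => cosTransform n ξ * F ξ) ∈ dualCone (unimodalityKernels E) := by
  rw [mem_dualCone_unimodalityKernels] at hF ⊢
  refine ⟨integrable_cosTransform_mul hn hF.1, ?_⟩
  have h := hF.2.convolution hanti (integrable_mul_cosTransform_sub hn hF.1)
  intro x y hxy
  have heven : ∀ z, n (-z) = n z := fun z => hanti.eq_of_norm_eq (norm_neg z)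
  rw [cosTransform_cosTransform_mul hn hF.1 heven, cosTransform_cosTransform_mul hn hF.1 heven]
  exact h hxy

theorem gaussian_mem_positivity {b : ℝ} (hb : 0 < b) :
    (fun ξ : E => Real.exp (-b * ‖ξ‖ ^ 2)) ∈ dualCone (positivityKernels E) := by
  rw [mem_dualCone_positivityKernels]
  refine ⟨integrable_gaussian hb, fun x => ?_⟩
  rw [cosTransform_gaussian hb]
  positivity

theorem gaussian_mem_unimodality {b : ℝ} (hb : 0 < b) :
    (fun ξ : E => Real.exp (-b * ‖ξ‖ ^ 2)) ∈ dualCone (unimodalityKernels E) := by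
  rw [mem_dualCone_unimodalityKernels]
  refine ⟨integrable_gaussian hb, fun x y hxy => ?_⟩
  rw [cosTransform_gaussian hb, cosTransform_gaussian hb]
  gcongr

end DualCone

section LevyExponent

variable {E : Type*} [NormedAddCommGroup E] [InnerProductSpace ℝ E]

theorem one_sub_cos_inner_nonneg (ξ z : E) : 0 ≤ 1 - Real.cos ⟪ξ, z⟫ :=
  sub_nonneg.mpr (Real.cos_le_one _)

theorem one_sub_cos_inner_le (ξ z : E) :
    1 - Real.cos ⟪ξ, z⟫ ≤ 2 * (1 + ‖ξ‖ ^ 2) * min (‖z‖ ^ 2) 1 := by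
  rcases le_total (‖z‖ ^ 2) 1 with h | h
  · rw [min_eq_left h]
    have h1 := Real.one_sub_sq_div_two_le_cos (x := ⟪ξ, z⟫)
    have h2 : ⟪ξ, z⟫ ^ 2 ≤ ‖ξ‖ ^ 2 * ‖z‖ ^ 2 := by
      rw [← mul_pow, ← sq_abs]
      exact pow_le_pow_left₀ (abs_nonneg _) (abs_real_inner_le_norm ξ z) 2
    nlinarith [sq_nonneg ‖z‖, mul_nonneg (sq_nonneg ‖ξ‖) (sq_nonneg ‖z‖)]
  · rw [min_eq_right h]
    nlinarith [Real.neg_one_le_cos ⟪ξ, z⟫, sq_nonneg ‖ξ‖]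

theorem abs_one_sub_cos_inner_le (ξ z : E) :
    |1 - Real.cos ⟪ξ, z⟫| ≤ 2 * (1 + ‖ξ‖ ^ 2) * min (‖z‖ ^ 2) 1 := by
  rw [abs_of_nonneg (one_sub_cos_inner_nonneg ξ z)]
  exact one_sub_cos_inner_le ξ z

theorem one_sub_cos_mul_nonneg {n : E → ℝ} (h0 : ∀ z ≠ 0, 0 ≤ n z) (ξ z : E) :
    0 ≤ (1 - Real.cos ⟪ξ, z⟫) * n z := by
  rcases eq_or_ne z 0 with rfl | hz
  · simp
  · exact mul_nonneg (one_sub_cos_inner_nonneg ξ z) (h0 z hz)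

variable [FiniteDimensional ℝ E] [MeasurableSpace E] [BorelSpace E]

/-- The Lévy–Khintchine exponent of a symmetric Lévy density `n`. -/
def levyExponent (n : E → ℝ) (ξ : E) : ℝ := ∫ z, (1 - Real.cos ⟪ξ, z⟫) * n z

/-- Pruitt's function of a Lévy density `n`, as a function of the squared radius. -/
def levyTail (n : E → ℝ) (u : ℝ) : ℝ := ∫ z, min (‖z‖ ^ 2 / u) 1 * n z

theorem integrable_mul_of_le_min {n φ : E → ℝ}
    (hn : Integrable (fun z => min (‖z‖ ^ 2) 1 * n z)) (hφ : Measurable φ) {C : ℝ}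
    (hC : ∀ z, |φ z| ≤ C * min (‖z‖ ^ 2) 1) : Integrable (fun z => φ z * n z) := by
  have h := hn.bdd_mul (c := |C|) (f := fun z => φ z / min (‖z‖ ^ 2) 1)
    (hφ.div (by fun_prop)).aestronglyMeasurable (Eventually.of_forall fun z => ?_)
  · refine h.congr (Eventually.of_forall fun z => ?_)
    rcases eq_or_ne (min (‖z‖ ^ 2) 1) 0 with h0 | h0
    · have : φ z = 0 := by simpa [h0] using hC z
      simp [this]
    · simp only
      rw [← mul_assoc, div_mul_cancel₀ _ h0]
  · have h0 : 0 ≤ min (‖z‖ ^ 2) 1 := by positivity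
    rw [Real.norm_eq_abs, abs_div, abs_of_nonneg h0]
    refine div_le_of_le_mul₀ h0 (abs_nonneg _) ((hC z).trans ?_)
    exact mul_le_mul_of_nonneg_right (le_abs_self _) h0

theorem integrable_one_sub_cos_mul {n : E → ℝ}
    (hn : Integrable (fun z => min (‖z‖ ^ 2) 1 * n z)) (ξ : E) :
    Integrable (fun z => (1 - Real.cos ⟪ξ, z⟫) * n z) :=
  integrable_mul_of_le_min hn (by fun_prop) (abs_one_sub_cos_inner_le ξ)

theorem levyExponent_nonneg {n : E → ℝ} (h0 : ∀ z ≠ 0, 0 ≤ n z) (ξ : E) :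
    0 ≤ levyExponent n ξ :=
  integral_nonneg fun z => one_sub_cos_mul_nonneg h0 ξ z

theorem levyExponent_zero (n : E → ℝ) : levyExponent n 0 = 0 := by
  simp [levyExponent]

theorem continuous_levyExponent {n : E → ℝ}
    (hn : Integrable (fun z => min (‖z‖ ^ 2) 1 * n z)) : Continuous (levyExponent n) := by
  refine continuous_iff_continuousAt.mpr fun ξ₀ => ?_
  refine continuousAt_of_dominated
    (bound := fun z => 2 * (1 + (‖ξ₀‖ + 1) ^ 2) * |min (‖z‖ ^ 2) 1 * n z|)
    (Eventually.of_forall fun ξ => (integrable_one_sub_cos_mul hn ξ).aestronglyMeasurable) ?_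
    (hn.abs.const_mul _) (Eventually.of_forall fun z => by fun_prop)
  filter_upwards [Metric.ball_mem_nhds ξ₀ one_pos] with ξ hξ
  refine Eventually.of_forall fun z => ?_
  have h1 : ‖ξ‖ ≤ ‖ξ₀‖ + 1 := by
    have := norm_sub_norm_le ξ ξ₀
    rw [mem_ball_iff_norm] at hξ
    linarith
  have h0 : 0 ≤ min (‖z‖ ^ 2) 1 := by positivity
  rw [norm_mul, abs_mul, abs_of_nonneg h0, ← mul_assoc, Real.norm_eq_abs, Real.norm_eq_abs]
  refine mul_le_mul_of_nonneg_right ((abs_one_sub_cos_inner_le ξ z).trans ?_) (abs_nonneg _)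
  gcongr

theorem integrable_min_mul {n : E → ℝ} (hn : Integrable n) :
    Integrable (fun z => min (‖z‖ ^ 2) 1 * n z) := by
  refine hn.bdd_mul (c := 1) (Continuous.aestronglyMeasurable (by fun_prop)) ?_
  refine Eventually.of_forall fun z => ?_
  rw [Real.norm_eq_abs, abs_of_nonneg (by positivity)]
  exact min_le_right _ _

theorem levyExponent_eq_sub_cosTransform {n : E → ℝ} (hn : Integrable n) (ξ : E) :
    levyExponent n ξ = (∫ z, n z) - cosTransform n ξ := by
  simp only [levyExponent, cosTransform, sub_mul, one_mul]
  exact integral_sub hn (integrable_cos_inner_mul hn ξ)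

theorem levyExponent_sub {n m : E → ℝ} (hn : Integrable (fun z => min (‖z‖ ^ 2) 1 * n z))
    (hm : Integrable (fun z => min (‖z‖ ^ 2) 1 * m z)) (ξ : E) :
    levyExponent (fun z => n z - m z) ξ = levyExponent n ξ - levyExponent m ξ := by
  simp only [levyExponent, mul_sub]
  exact integral_sub (integrable_one_sub_cos_mul hn ξ) (integrable_one_sub_cos_mul hm ξ)

/-- If multiplication by the transforms of integrable densities increasing to the Lévy density `n`
preserves the cone, then so does the convolution semigroup with exponent `levyExponent n`. -/
theorem exp_levyExponent_mul_mem_dualCone {A : Set (E → ℝ)} (hA : BoundedFamily A) {n : E → ℝ}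
    (hn : Integrable (fun z => min (‖z‖ ^ 2) 1 * n z)) {m : ℕ → E → ℝ}
    (hm : ∀ k, Integrable (m k)) (hm0 : ∀ k z, 0 ≤ m k z) (hmn : ∀ k, ∀ z ≠ 0, m k z ≤ n z)
    (hlim : ∀ z ≠ 0, Tendsto (fun k => m k z) atTop (nhds (n z)))
    (hmul : ∀ k, ∀ F ∈ dualCone A, (fun ξ => cosTransform (m k) ξ * F ξ) ∈ dualCone A)
    {F : E → ℝ} (hF : F ∈ dualCone A) {T : ℝ} (hT : 0 ≤ T) :
    (fun ξ => Real.exp (-(T * levyExponent n ξ)) * F ξ) ∈ dualCone A := by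
  refine dualCone_of_tendsto hA
    (F := fun k ξ => Real.exp (-(T * levyExponent (m k) ξ)) * F ξ) (G := fun ξ => |F ξ|)
    (fun k => ?_) hF.1.abs (fun k ξ => ?_) (fun ξ => ?_)
  · have h := dualCone_const_mul (dualCone_exp_mul hA (abs_cosTransform_le (hm k)) (hmul k) hF hT)
      (c := Real.exp (-(T * ∫ z, m k z))) (Real.exp_pos _).le
    refine (congrArg (· ∈ dualCone A) ?_).mp h
    ext ξ
    rw [← mul_assoc, ← Real.exp_add, levyExponent_eq_sub_cosTransform (hm k)]
    congr 2
    ring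
  · rw [abs_mul, abs_of_nonneg (Real.exp_pos _).le]
    refine mul_le_of_le_one_left (abs_nonneg _) (Real.exp_le_one_iff.mpr ?_)
    have := levyExponent_nonneg (fun z _ => hm0 k z) ξ
    nlinarith [mul_nonneg hT this]
  · have h : Tendsto (fun k => levyExponent (m k) ξ) atTop (nhds (levyExponent n ξ)) := by
      refine tendsto_integral_of_dominated_convergence
        (fun z => (1 - Real.cos ⟪ξ, z⟫) * n z)
        (fun k => (integrable_one_sub_cos_mul (integrable_min_mul (hm k)) ξ).aestronglyMeasurable)
        (integrable_one_sub_cos_mul hn ξ) (fun k => Eventually.of_forall fun z => ?_)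
        (Eventually.of_forall fun z => ?_)
      · rw [Real.norm_eq_abs, abs_of_nonneg (one_sub_cos_mul_nonneg (fun z _ => hm0 k z) ξ z)]
        rcases eq_or_ne z 0 with rfl | hz
        · simp
        · exact mul_le_mul_of_nonneg_left (hmn k z hz) (one_sub_cos_inner_nonneg ξ z)
      · rcases eq_or_ne z 0 with rfl | hz
        · simp
        · exact (hlim z hz).const_mul _
    exact (Real.continuous_exp.tendsto _).comp ((h.const_mul T).neg) |>.mul_const _

theorem integrable_one_add_sq_mul_gaussian {b : ℝ} (hb : 0 < b) :
    Integrable (fun ξ : E => (1 + ‖ξ‖ ^ 2) * Real.exp (-b * ‖ξ‖ ^ 2)) := by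
  refine ((integrable_gaussian (E := E) (half_pos hb)).const_mul (1 + 2 / b)).mono'
    (Continuous.aestronglyMeasurable (by fun_prop)) (Eventually.of_forall fun ξ => ?_)
  rw [Real.norm_eq_abs, abs_of_nonneg (by positivity)]
  have h1 := Real.add_one_le_exp (b / 2 * ‖ξ‖ ^ 2)
  have h2 : 1 + ‖ξ‖ ^ 2 ≤ (1 + 2 / b) * Real.exp (b / 2 * ‖ξ‖ ^ 2) := by
    calc 1 + ‖ξ‖ ^ 2 ≤ (1 + 2 / b) * (b / 2 * ‖ξ‖ ^ 2 + 1) := by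
          have : (1 + 2 / b) * (b / 2 * ‖ξ‖ ^ 2 + 1)
            = 1 + ‖ξ‖ ^ 2 + (b / 2 * ‖ξ‖ ^ 2 + 2 / b) := by field_simp; ring
          rw [this]
          have : 0 ≤ b / 2 * ‖ξ‖ ^ 2 + 2 / b := by positivity
          linarith
      _ ≤ _ := by gcongr
  calc (1 + ‖ξ‖ ^ 2) * Real.exp (-b * ‖ξ‖ ^ 2)
      ≤ (1 + 2 / b) * Real.exp (b / 2 * ‖ξ‖ ^ 2) * Real.exp (-b * ‖ξ‖ ^ 2) := by gcongr
    _ = (1 + 2 / b) * Real.exp (-(b / 2) * ‖ξ‖ ^ 2) := by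
        rw [mul_assoc, ← Real.exp_add]; congr 2; ring

theorem integral_gaussian_mul_levyExponent {n : E → ℝ}
    (hn : Integrable (fun z => min (‖z‖ ^ 2) 1 * n z)) {b : ℝ} (hb : 0 < b) :
    Integrable (fun ξ => Real.exp (-b * ‖ξ‖ ^ 2) * levyExponent n ξ) ∧
    ∫ ξ, Real.exp (-b * ‖ξ‖ ^ 2) * levyExponent n ξ
      = (π / b) ^ (Module.finrank ℝ E / 2 : ℝ) *
        ∫ z, (1 - Real.exp (-(‖z‖ ^ 2 / (4 * b)))) * n z := by
  have hprod : Integrable (Function.uncurry fun ξ z : E =>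
      Real.exp (-b * ‖ξ‖ ^ 2) * ((1 - Real.cos ⟪ξ, z⟫) * n z)) := by
    have h := (integrable_one_add_sq_mul_gaussian (E := E) hb).mul_prod hn
    have h' := h.bdd_mul (c := 2) (f := fun p : E × E =>
      (1 - Real.cos ⟪p.1, p.2⟫) / ((1 + ‖p.1‖ ^ 2) * min (‖p.2‖ ^ 2) 1))
      (Measurable.aestronglyMeasurable (by fun_prop)) (Eventually.of_forall fun p => ?_)
    · refine h'.congr (Eventually.of_forall fun p => ?_)
      rcases eq_or_ne p.2 0 with h0 | h0
      · simp [Function.uncurry, h0]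
      · have h1 : min (‖p.2‖ ^ 2) 1 ≠ 0 := by positivity
        have h2 : 1 + ‖p.1‖ ^ 2 ≠ 0 := by positivity
        simp only [Function.uncurry]
        field_simp
    · have h0 : 0 ≤ min (‖p.2‖ ^ 2) 1 := by positivity
      rw [Real.norm_eq_abs, abs_div, abs_of_nonneg (a := (1 + ‖p.1‖ ^ 2) * _) (by positivity)]
      refine div_le_of_le_mul₀ (by positivity) (by norm_num) ?_
      rw [← mul_assoc]
      exact abs_one_sub_cos_inner_le p.1 p.2
  have hswap := integral_integral_swap hprod
  constructor
  · have := hprod.integral_prod_left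
    refine this.congr (Eventually.of_forall fun ξ => ?_)
    simp only [Function.uncurry, integral_const_mul, levyExponent]
  · simp only [levyExponent, ← integral_const_mul]
    rw [hswap]
    refine integral_congr_ae (Eventually.of_forall fun z => ?_)
    have h1 : ∀ ξ : E, Real.exp (-b * ‖ξ‖ ^ 2) * ((1 - Real.cos ⟪ξ, z⟫) * n z)
        = (Real.exp (-b * ‖ξ‖ ^ 2) - Real.cos ⟪z, ξ⟫ * Real.exp (-b * ‖ξ‖ ^ 2)) * n z := by
      intro ξ; rw [real_inner_comm z ξ]; ring
    simp only [h1]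
    rw [integral_mul_const, integral_sub (integrable_gaussian hb)
      (integrable_cos_inner_mul (integrable_gaussian hb) z),
      GaussianFourier.integral_rexp_neg_mul_sq_norm hb]
    have := cosTransform_gaussian hb z
    unfold cosTransform at this
    rw [this]
    ring

theorem integrable_min_div_mul {n : E → ℝ}
    (hn : Integrable (fun z => min (‖z‖ ^ 2) 1 * n z)) {u : ℝ} (hu : 0 < u) :
    Integrable (fun z => min (‖z‖ ^ 2 / u) 1 * n z) := by
  refine integrable_mul_of_le_min hn (C := 1 + 1 / u) (by fun_prop) fun z => ?_
  rw [abs_of_nonneg (by positivity)]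
  have h1 : ‖z‖ ^ 2 / u = 1 / u * ‖z‖ ^ 2 := by ring
  have hu' : 0 < 1 / u := by positivity
  rcases le_total (‖z‖ ^ 2) 1 with h | h
  · rw [min_eq_left h]
    refine (min_le_left _ _).trans ?_
    rw [h1]
    nlinarith [sq_nonneg ‖z‖]
  · rw [min_eq_right h]
    refine (min_le_right _ _).trans ?_
    linarith

theorem min_mul_nonneg {E : Type*} [NormedAddCommGroup E] {n : E → ℝ}
    (h0 : ∀ z ≠ 0, 0 ≤ n z) {u : ℝ} (hu : 0 < u) (z : E) :
    0 ≤ min (‖z‖ ^ 2 / u) 1 * n z := by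
  rcases eq_or_ne z 0 with rfl | hz
  · simp
  · exact mul_nonneg (by positivity) (h0 z hz)

theorem integral_gaussian_mul_levyExponent_le {n : E → ℝ}
    (hn : Integrable (fun z => min (‖z‖ ^ 2) 1 * n z)) (h0 : ∀ z ≠ 0, 0 ≤ n z) {b : ℝ}
    (hb : 0 < b) :
    ∫ ξ, Real.exp (-b * ‖ξ‖ ^ 2) * levyExponent n ξ
      ≤ (π / b) ^ (Module.finrank ℝ E / 2 : ℝ) * levyTail n (4 * b) := by
  rw [(integral_gaussian_mul_levyExponent hn hb).2]
  refine mul_le_mul_of_nonneg_left ?_ (by positivity)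
  have hle : ∀ z : E, 1 - Real.exp (-(‖z‖ ^ 2 / (4 * b))) ≤ min (‖z‖ ^ 2 / (4 * b)) 1 := by
    intro z
    refine le_min ?_ ?_
    · linarith [Real.add_one_le_exp (-(‖z‖ ^ 2 / (4 * b)))]
    · linarith [Real.exp_pos (-(‖z‖ ^ 2 / (4 * b)))]
  have hnonneg : ∀ z : E, 0 ≤ 1 - Real.exp (-(‖z‖ ^ 2 / (4 * b))) := by
    intro z
    have : 0 ≤ ‖z‖ ^ 2 / (4 * b) := by positivity
    linarith [Real.exp_le_one_iff.mpr (neg_nonpos.mpr this)]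
  refine integral_mono_of_nonneg (Eventually.of_forall fun z => ?_)
    (integrable_min_div_mul hn (by positivity)) (Eventually.of_forall fun z => ?_)
  · rcases eq_or_ne z 0 with rfl | hz
    · simp
    · exact mul_nonneg (hnonneg z) (h0 z hz)
  · rcases eq_or_ne z 0 with rfl | hz
    · simp
    · exact mul_le_mul_of_nonneg_right (hle z) (h0 z hz)

theorem continuous_exp_neg_levyExponent {n : E → ℝ}
    (hn : Integrable (fun z => min (‖z‖ ^ 2) 1 * n z)) (T : ℝ) :
    Continuous (fun ξ => Real.exp (-(T * levyExponent n ξ))) := by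
  have := continuous_levyExponent hn
  fun_prop

theorem exp_neg_levyExponent_le_one {n : E → ℝ} (h0 : ∀ z ≠ 0, 0 ≤ n z) {T : ℝ} (hT : 0 ≤ T)
    (ξ : E) : Real.exp (-(T * levyExponent n ξ)) ≤ 1 :=
  Real.exp_le_one_iff.mpr (neg_nonpos.mpr (mul_nonneg hT (levyExponent_nonneg h0 ξ)))

theorem integrable_gaussian_mul_exp {n : E → ℝ}
    (hn : Integrable (fun z => min (‖z‖ ^ 2) 1 * n z)) (h0 : ∀ z ≠ 0, 0 ≤ n z) {T b : ℝ}
    (hT : 0 ≤ T) (hb : 0 < b) :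
    Integrable (fun ξ => Real.exp (-b * ‖ξ‖ ^ 2) * Real.exp (-(T * levyExponent n ξ))) := by
  refine (integrable_gaussian hb).mul_bdd (c := 1)
    (continuous_exp_neg_levyExponent hn T).aestronglyMeasurable (Eventually.of_forall fun ξ => ?_)
  rw [Real.norm_eq_abs, abs_of_nonneg (Real.exp_pos _).le]
  exact exp_neg_levyExponent_le_one h0 hT ξ

theorem integral_gaussian_mul_exp_le {n : E → ℝ}
    (hn : Integrable (fun z => min (‖z‖ ^ 2) 1 * n z)) (h0 : ∀ z ≠ 0, 0 ≤ n z) {T b : ℝ}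
    (hT : 0 ≤ T) (hb : 0 < b) :
    ∫ ξ, Real.exp (-b * ‖ξ‖ ^ 2) * Real.exp (-(T * levyExponent n ξ))
      ≤ (π / b) ^ (Module.finrank ℝ E / 2 : ℝ) := by
  rw [← GaussianFourier.integral_rexp_neg_mul_sq_norm hb]
  refine integral_mono (integrable_gaussian_mul_exp hn h0 hT hb) (integrable_gaussian hb)
    fun ξ => ?_
  exact mul_le_of_le_one_right (Real.exp_pos _).le (exp_neg_levyExponent_le_one h0 hT ξ)

theorem le_integral_gaussian_mul_exp {n : E → ℝ}
    (hn : Integrable (fun z => min (‖z‖ ^ 2) 1 * n z)) (h0 : ∀ z ≠ 0, 0 ≤ n z) {T b : ℝ}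
    (hT : 0 ≤ T) (hb : 0 < b) :
    (π / b) ^ (Module.finrank ℝ E / 2 : ℝ) * (1 - T * levyTail n (4 * b))
      ≤ ∫ ξ, Real.exp (-b * ‖ξ‖ ^ 2) * Real.exp (-(T * levyExponent n ξ)) := by
  have h1 := integral_gaussian_mul_levyExponent_le hn h0 hb
  have hi := (integral_gaussian_mul_levyExponent hn hb).1
  have h2 : ∫ ξ, (Real.exp (-b * ‖ξ‖ ^ 2) - T * (Real.exp (-b * ‖ξ‖ ^ 2) * levyExponent n ξ))
      ≤ ∫ ξ, Real.exp (-b * ‖ξ‖ ^ 2) * Real.exp (-(T * levyExponent n ξ)) := by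
    refine integral_mono ((integrable_gaussian hb).sub (hi.const_mul T))
      (integrable_gaussian_mul_exp hn h0 hT hb) fun ξ => ?_
    have := Real.add_one_le_exp (-(T * levyExponent n ξ))
    have h3 := mul_le_mul_of_nonneg_left this (Real.exp_pos (-b * ‖ξ‖ ^ 2)).le
    simp only
    linarith
  rw [integral_sub (integrable_gaussian hb) (hi.const_mul T), integral_const_mul,
    GaussianFourier.integral_rexp_neg_mul_sq_norm hb] at h2
  have h3 := mul_le_mul_of_nonneg_left h1 hT
  linarith

end LevyExponent

section RadialCap

variable {E : Type*} [NormedAddCommGroup E]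

/-- The radial density `ν ‖z‖` truncated to be constant on the ball of radius `ε`. -/
def radialCap (ν : ℝ → ℝ) (ε : ℝ) (z : E) : ℝ := ν (max ‖z‖ ε)

variable {ν : ℝ → ℝ}

theorem radialCap_pos (hpos : ∀ r, 0 < r → 0 < ν r) {ε : ℝ} (hε : 0 < ε) (z : E) :
    0 < radialCap ν ε z := hpos _ (lt_max_of_lt_right hε)

theorem radialCap_neg (ε : ℝ) (z : E) : radialCap ν ε (-z) = radialCap ν ε z := by
  simp [radialCap]

theorem radiallyAntitone_radialCap (hmono : ∀ r₁ r₂, 0 < r₁ → r₁ ≤ r₂ → ν r₂ ≤ ν r₁) {ε : ℝ}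
    (hε : 0 < ε) : RadiallyAntitone (radialCap ν ε : E → ℝ) := fun _ _ h =>
  hmono _ _ (lt_max_of_lt_right hε) (max_le_max_right ε h)

theorem radialCap_anti (hmono : ∀ r₁ r₂, 0 < r₁ → r₁ ≤ r₂ → ν r₂ ≤ ν r₁) {ε R : ℝ}
    (hε : 0 < ε) (h : ε ≤ R) (z : E) : radialCap ν R z ≤ radialCap ν ε z :=
  hmono _ _ (lt_max_of_lt_right hε) (max_le_max_left _ h)

theorem radialCap_le (hmono : ∀ r₁ r₂, 0 < r₁ → r₁ ≤ r₂ → ν r₂ ≤ ν r₁) (ε : ℝ) {z : E}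
    (hz : z ≠ 0) : radialCap ν ε z ≤ ν ‖z‖ :=
  hmono _ _ (norm_pos_iff.mpr hz) (le_max_left _ _)

theorem radialCap_of_le {ε : ℝ} {z : E} (h : ε ≤ ‖z‖) : radialCap ν ε z = ν ‖z‖ := by
  rw [radialCap, max_eq_left h]

theorem radialCap_of_norm_le {ε : ℝ} {z : E} (h : ‖z‖ ≤ ε) : radialCap ν ε z = ν ε := by
  rw [radialCap, max_eq_right h]

theorem tendsto_radialCap {z : E} (hz : z ≠ 0) :
    Tendsto (fun k : ℕ => radialCap ν (1 / ((k : ℝ) + 1)) z) atTop (nhds (ν ‖z‖)) := by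
  refine tendsto_const_nhds.congr' ?_
  filter_upwards [tendsto_one_div_add_atTop_nhds_zero_nat.eventually
    (ge_mem_nhds (norm_pos_iff.mpr hz))] with k hk
  exact (radialCap_of_le hk).symm

theorem measurable_radialCap [MeasurableSpace E] [BorelSpace E]
    (hmono : ∀ r₁ r₂, 0 < r₁ → r₁ ≤ r₂ → ν r₂ ≤ ν r₁) {ε : ℝ} (hε : 0 < ε) :
    Measurable (radialCap ν ε : E → ℝ) := by
  have h : Antitone (fun r => ν (max r ε)) := fun r s hrs =>
    hmono _ _ (lt_max_of_lt_right hε) (max_le_max_right ε hrs)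
  exact h.measurable.comp measurable_norm

theorem radialCap_le_indicator_add (hpos : ∀ r, 0 < r → 0 < ν r) {R : ℝ} (hR : 0 < R) (z : E) :
    radialCap ν R z ≤ (Metric.closedBall (0 : E) R).indicator (fun _ => ν R) z
      + min (‖z‖ ^ 2 / R ^ 2) 1 * ν ‖z‖ := by
  rcases le_or_gt ‖z‖ R with h | h
  · rw [radialCap_of_norm_le h, Set.indicator_of_mem (by simpa using h)]
    rcases eq_or_ne z 0 with rfl | hz
    · simp
    · have := (hpos _ (norm_pos_iff.mpr hz)).le
      have : 0 ≤ min (‖z‖ ^ 2 / R ^ 2) 1 * ν ‖z‖ := by positivity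
      linarith
  · rw [radialCap_of_le h.le, Set.indicator_of_notMem (by simpa using h), min_eq_right, zero_add,
      one_mul]
    rw [le_div_iff₀ (by positivity), one_mul]
    gcongr

variable [InnerProductSpace ℝ E] [FiniteDimensional ℝ E] [MeasurableSpace E] [BorelSpace E]

theorem integrable_indicator_closedBall (R c : ℝ) :
    Integrable ((Metric.closedBall (0 : E) R).indicator (fun _ => c)) :=
  (integrable_indicator_iff Metric.isClosed_closedBall.measurableSet).mpr
    (integrableOn_const (isCompact_closedBall _ _).measure_lt_top.ne)

theorem integrable_radialCap (hpos : ∀ r, 0 < r → 0 < ν r)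
    (hmono : ∀ r₁ r₂, 0 < r₁ → r₁ ≤ r₂ → ν r₂ ≤ ν r₁)
    (hn : Integrable (fun z : E => min (‖z‖ ^ 2) 1 * ν ‖z‖)) {R : ℝ} (hR : 0 < R) :
    Integrable (radialCap ν R : E → ℝ) := by
  refine ((integrable_indicator_closedBall R (ν R)).add
    (integrable_min_div_mul hn (pow_pos hR 2))).mono'
    (measurable_radialCap hmono hR).aestronglyMeasurable (Eventually.of_forall fun z => ?_)
  rw [Real.norm_eq_abs, abs_of_pos (radialCap_pos hpos hR z)]
  exact radialCap_le_indicator_add hpos hR z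

theorem integral_radialCap_le (hpos : ∀ r, 0 < r → 0 < ν r)
    (hmono : ∀ r₁ r₂, 0 < r₁ → r₁ ≤ r₂ → ν r₂ ≤ ν r₁)
    (hn : Integrable (fun z : E => min (‖z‖ ^ 2) 1 * ν ‖z‖)) {R : ℝ} (hR : 0 < R) :
    ∫ z : E, radialCap ν R z ≤ volume.real (Metric.closedBall (0 : E) R) * ν R
      + levyTail (fun z : E => ν ‖z‖) (R ^ 2) := by
  have h := integral_mono (integrable_radialCap hpos hmono hn hR)
    ((integrable_indicator_closedBall R (ν R)).add (integrable_min_div_mul hn (pow_pos hR 2)))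
    (radialCap_le_indicator_add hpos hR)
  simp only [Pi.add_apply] at h
  rw [integral_add (integrable_indicator_closedBall R (ν R))
    (integrable_min_div_mul hn (pow_pos hR 2)),
    integral_indicator_const _ Metric.isClosed_closedBall.measurableSet] at h
  exact h

end RadialCap

section HeatKernel

variable {E : Type*} [NormedAddCommGroup E] [InnerProductSpace ℝ E] [FiniteDimensional ℝ E]
  [MeasurableSpace E] [BorelSpace E]

theorem exp_levyExponent_mem_dualCone {A : Set (E → ℝ)} (hA : BoundedFamily A) {n : E → ℝ}
    (hn : Integrable (fun z => min (‖z‖ ^ 2) 1 * n z)) {m : ℕ → E → ℝ}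
    (hm : ∀ k, Integrable (m k)) (hm0 : ∀ k z, 0 ≤ m k z) (hmn : ∀ k, ∀ z ≠ 0, m k z ≤ n z)
    (hlim : ∀ z ≠ 0, Tendsto (fun k => m k z) atTop (nhds (n z)))
    (hmul : ∀ k, ∀ F ∈ dualCone A, (fun ξ => cosTransform (m k) ξ * F ξ) ∈ dualCone A)
    (hgauss : ∀ b : ℝ, 0 < b → (fun ξ : E => Real.exp (-b * ‖ξ‖ ^ 2)) ∈ dualCone A)
    {T : ℝ} (hT : 0 ≤ T) (hint : Integrable (fun ξ => Real.exp (-(T * levyExponent n ξ)))) :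
    (fun ξ => Real.exp (-(T * levyExponent n ξ))) ∈ dualCone A := by
  refine dualCone_of_tendsto hA (fun k : ℕ => exp_levyExponent_mul_mem_dualCone hA hn hm hm0 hmn
    hlim hmul (hgauss (1 / ((k : ℝ) + 1)) (by positivity)) hT) hint (fun k ξ => ?_) (fun ξ => ?_)
  · rw [abs_of_pos (by positivity)]
    refine mul_le_of_le_one_right (Real.exp_pos _).le (Real.exp_le_one_iff.mpr ?_)
    have : 0 ≤ 1 / ((k : ℝ) + 1) * ‖ξ‖ ^ 2 := by positivity
    linarith
  · have h := (tendsto_one_div_add_atTop_nhds_zero_nat (𝕜 := ℝ)).neg.mul_const (‖ξ‖ ^ 2)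
    have h' := ((Real.continuous_exp.tendsto _).comp h).const_mul
      (Real.exp (-(T * levyExponent n ξ)))
    simpa using h'

theorem gaussian_constants_mul {b : ℝ} (hb : 0 < b) (d : ℕ) :
    (π / b) ^ (d / 2 : ℝ) * (π / (1 / (4 * b))) ^ (d / 2 : ℝ) = (2 * π) ^ d := by
  rw [← Real.mul_rpow (by positivity) (by positivity)]
  have : π / b * (π / (1 / (4 * b))) = (2 * π) ^ (2 : ℝ) := by
    rw [Real.rpow_two]; field_simp; norm_num
  rw [this, ← Real.rpow_mul (by positivity), mul_div_cancel₀ _ two_ne_zero, Real.rpow_natCast]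

theorem integral_gaussian_mul_heatKernel {n : E → ℝ} {T b : ℝ}
    (hint : Integrable (fun ξ => Real.exp (-(T * levyExponent n ξ)))) (hb : 0 < b) :
    ∫ y, Real.exp (-b * ‖y‖ ^ 2) * cosTransform (fun ξ => Real.exp (-(T * levyExponent n ξ))) y
      = (π / b) ^ (Module.finrank ℝ E / 2 : ℝ) *
        ∫ ξ, Real.exp (-(1 / (4 * b)) * ‖ξ‖ ^ 2) * Real.exp (-(T * levyExponent n ξ)) := by
  rw [integral_gaussian_mul_cosTransform hint hb]
  congr 2
  ext ξ
  congr 2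
  ring

theorem integral_gaussian_mul_heatKernel_le {n : E → ℝ}
    (hn : Integrable (fun z => min (‖z‖ ^ 2) 1 * n z)) (h0 : ∀ z ≠ 0, 0 ≤ n z) {T b : ℝ}
    (hT : 0 ≤ T) (hint : Integrable (fun ξ => Real.exp (-(T * levyExponent n ξ)))) (hb : 0 < b) :
    ∫ y, Real.exp (-b * ‖y‖ ^ 2) * cosTransform (fun ξ => Real.exp (-(T * levyExponent n ξ))) y
      ≤ (2 * π) ^ Module.finrank ℝ E := by
  rw [integral_gaussian_mul_heatKernel hint hb, ← gaussian_constants_mul hb]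
  exact mul_le_mul_of_nonneg_left (integral_gaussian_mul_exp_le hn h0 hT (by positivity))
    (by positivity)

theorem le_integral_gaussian_mul_heatKernel {n : E → ℝ}
    (hn : Integrable (fun z => min (‖z‖ ^ 2) 1 * n z)) (h0 : ∀ z ≠ 0, 0 ≤ n z) {T b : ℝ}
    (hT : 0 ≤ T) (hint : Integrable (fun ξ => Real.exp (-(T * levyExponent n ξ)))) (hb : 0 < b) :
    (2 * π) ^ Module.finrank ℝ E * (1 - T * levyTail n (1 / b)) ≤
      ∫ y, Real.exp (-b * ‖y‖ ^ 2) *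
        cosTransform (fun ξ => Real.exp (-(T * levyExponent n ξ))) y := by
  rw [integral_gaussian_mul_heatKernel hint hb, ← gaussian_constants_mul hb, mul_assoc]
  have h := le_integral_gaussian_mul_exp hn h0 hT (b := 1 / (4 * b)) (by positivity)
  rw [show 4 * (1 / (4 * b)) = 1 / b by field_simp] at h
  exact mul_le_mul_of_nonneg_left h (by positivity)

theorem integrable_gaussian_mul_cosTransform {F : E → ℝ} (hF : Integrable F) {b : ℝ}
    (hb : 0 < b) : Integrable (fun y => Real.exp (-b * ‖y‖ ^ 2) * cosTransform F y) :=
  (integrable_gaussian hb).mul_bdd (continuous_cosTransform hF).aestronglyMeasurable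
    (Eventually.of_forall (abs_cosTransform_le hF))

theorem heatKernel_le_levyTail {n : E → ℝ}
    (hn : Integrable (fun z => min (‖z‖ ^ 2) 1 * n z)) (h0 : ∀ z ≠ 0, 0 ≤ n z) {T : ℝ}
    (hT : 0 ≤ T) (hint : Integrable (fun ξ => Real.exp (-(T * levyExponent n ξ))))
    (hpos : ∀ x, 0 ≤ cosTransform (fun ξ => Real.exp (-(T * levyExponent n ξ))) x)
    (hanti : RadiallyAntitone (cosTransform (fun ξ => Real.exp (-(T * levyExponent n ξ)))))
    {x : E} (hx : x ≠ 0) :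
    (Real.exp (-1 / 2) * (1 - Real.exp (-1 / 8))) *
        ((‖x‖ / 4) ^ Module.finrank ℝ E * volume.real (Metric.ball (0 : E) 1)) *
        cosTransform (fun ξ => Real.exp (-(T * levyExponent n ξ))) x
      ≤ (2 * π) ^ Module.finrank ℝ E * (T * levyTail n (‖x‖ ^ 2)) := by
  set f := cosTransform (fun ξ => Real.exp (-(T * levyExponent n ξ))) with hf
  set r := ‖x‖ with hr
  have hr0 : 0 < r := norm_pos_iff.mpr hx
  set c := 1 / (2 * r ^ 2) with hc
  have hc0 : 0 < c := by positivity
  have h1 := integral_gaussian_mul_heatKernel_le hn h0 hT hint hc0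
  have h2 := le_integral_gaussian_mul_heatKernel hn h0 hT hint (b := 2 * c) (by positivity)
  rw [← hf] at h1 h2
  have hc2 : 1 / (2 * c) = r ^ 2 := by rw [hc]; field_simp
  rw [hc2] at h2
  have hi1 := integrable_gaussian_mul_cosTransform hint hc0
  have hi2 := integrable_gaussian_mul_cosTransform hint (b := 2 * c) (by positivity)
  have h3 : ∫ y, (Metric.ball ((3 / 4 : ℝ) • x) (r / 4)).indicator
      (fun _ => (Real.exp (-1 / 2) * (1 - Real.exp (-1 / 8))) * f x) y ≤
      ∫ y, (Real.exp (-c * ‖y‖ ^ 2) * f y - Real.exp (-(2 * c) * ‖y‖ ^ 2) * f y) := by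
    refine integral_mono ((integrable_indicator_iff Metric.isOpen_ball.measurableSet).mpr
      (integrableOn_const measure_ball_lt_top.ne)) (hi1.sub hi2) fun y => ?_
    have hexp : Real.exp (-(2 * c) * ‖y‖ ^ 2)
        = Real.exp (-c * ‖y‖ ^ 2) * Real.exp (-c * ‖y‖ ^ 2) := by
      rw [← Real.exp_add]; congr 1; ring
    have hle1 : Real.exp (-c * ‖y‖ ^ 2) ≤ 1 := Real.exp_le_one_iff.mpr (by
      have : 0 ≤ c * ‖y‖ ^ 2 := by positivity
      linarith)
    by_cases hy : y ∈ Metric.ball ((3 / 4 : ℝ) • x) (r / 4)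
    · rw [Set.indicator_of_mem hy]
      rw [mem_ball_iff_norm] at hy
      have hxn : ‖(3 / 4 : ℝ) • x‖ = 3 / 4 * r := by
        rw [norm_smul, Real.norm_eq_abs, abs_of_pos (by norm_num)]
      have hyu : ‖y‖ ≤ r := by
        have := norm_le_norm_add_norm_sub' y ((3 / 4 : ℝ) • x)
        linarith
      have hyl : r / 2 ≤ ‖y‖ := by
        have := norm_le_norm_add_norm_sub y ((3 / 4 : ℝ) • x)
        linarith
      have hcu : c * ‖y‖ ^ 2 ≤ 1 / 2 := by
        calc c * ‖y‖ ^ 2 ≤ c * r ^ 2 := by gcongr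
          _ = 1 / 2 := by rw [hc]; field_simp
      have hcl : 1 / 8 ≤ c * ‖y‖ ^ 2 := by
        calc 1 / 8 = c * (r / 2) ^ 2 := by rw [hc]; field_simp; norm_num
          _ ≤ c * ‖y‖ ^ 2 := by gcongr
      have e1 : Real.exp (-1 / 2) ≤ Real.exp (-c * ‖y‖ ^ 2) := Real.exp_le_exp.mpr (by linarith)
      have e2 : Real.exp (-c * ‖y‖ ^ 2) ≤ Real.exp (-1 / 8) := Real.exp_le_exp.mpr (by linarith)
      have e3 : Real.exp (-1 / 8) ≤ 1 := Real.exp_le_one_iff.mpr (by norm_num)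
      calc (Real.exp (-1 / 2) * (1 - Real.exp (-1 / 8))) * f x
          ≤ (Real.exp (-c * ‖y‖ ^ 2) * (1 - Real.exp (-c * ‖y‖ ^ 2))) * f y := by
            refine mul_le_mul (mul_le_mul e1 (by linarith) (by linarith) (Real.exp_pos _).le)
              (hanti hyu) (hpos x) (mul_nonneg (Real.exp_pos _).le (by linarith))
        _ = _ := by rw [hexp]; ring
    · rw [Set.indicator_of_notMem hy, hexp]
      have : 0 ≤ (Real.exp (-c * ‖y‖ ^ 2) * (1 - Real.exp (-c * ‖y‖ ^ 2))) * f y :=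
        mul_nonneg (mul_nonneg (Real.exp_pos _).le (by linarith)) (hpos y)
      linarith
  rw [integral_indicator_const _ Metric.isOpen_ball.measurableSet, integral_sub hi1 hi2,
    Measure.real, Measure.addHaar_ball_of_pos _ _ (by positivity), ENNReal.toReal_mul,
    ENNReal.toReal_ofReal (by positivity), smul_eq_mul, ← Measure.real] at h3
  linarith

end HeatKernel

section HeatKernelLower

variable {E : Type*} [NormedAddCommGroup E] [InnerProductSpace ℝ E] [FiniteDimensional ℝ E]
  [MeasurableSpace E] [BorelSpace E] {ν : ℝ → ℝ}

theorem heatKernel_nonneg (hpos : ∀ r, 0 < r → 0 < ν r)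
    (hmono : ∀ r₁ r₂, 0 < r₁ → r₁ ≤ r₂ → ν r₂ ≤ ν r₁)
    (hn : Integrable (fun z : E => min (‖z‖ ^ 2) 1 * ν ‖z‖)) {T : ℝ} (hT : 0 ≤ T)
    (hint : Integrable (fun ξ : E => Real.exp (-(T * levyExponent (fun z => ν ‖z‖) ξ)))) (x : E) :
    0 ≤ cosTransform (fun ξ => Real.exp (-(T * levyExponent (fun z => ν ‖z‖) ξ))) x := by
  have hk : ∀ k : ℕ, (0 : ℝ) < 1 / (k + 1) := fun k => by positivity
  exact (mem_dualCone_positivityKernels.mp (exp_levyExponent_mem_dualCone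
    boundedFamily_positivityKernels hn (fun k => integrable_radialCap hpos hmono hn (hk k))
    (fun k z => (radialCap_pos hpos (hk k) z).le) (fun k z hz => radialCap_le hmono _ hz)
    (fun z hz => tendsto_radialCap hz)
    (fun k F hF => cosTransform_mul_mem_positivity (integrable_radialCap hpos hmono hn (hk k))
      (radialCap_neg _) (fun z => (radialCap_pos hpos (hk k) z).le) hF)
    (fun b hb => gaussian_mem_positivity hb) hT hint)).2 x

theorem radiallyAntitone_heatKernel (hpos : ∀ r, 0 < r → 0 < ν r)
    (hmono : ∀ r₁ r₂, 0 < r₁ → r₁ ≤ r₂ → ν r₂ ≤ ν r₁)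
    (hn : Integrable (fun z : E => min (‖z‖ ^ 2) 1 * ν ‖z‖)) {T : ℝ} (hT : 0 ≤ T)
    (hint : Integrable (fun ξ : E => Real.exp (-(T * levyExponent (fun z => ν ‖z‖) ξ)))) :
    RadiallyAntitone
      (cosTransform (fun ξ : E => Real.exp (-(T * levyExponent (fun z => ν ‖z‖) ξ)))) := by
  have hk : ∀ k : ℕ, (0 : ℝ) < 1 / (k + 1) := fun k => by positivity
  exact (mem_dualCone_unimodalityKernels.mp (exp_levyExponent_mem_dualCone
    boundedFamily_unimodalityKernels hn (fun k => integrable_radialCap hpos hmono hn (hk k))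
    (fun k z => (radialCap_pos hpos (hk k) z).le) (fun k z hz => radialCap_le hmono _ hz)
    (fun z hz => tendsto_radialCap hz)
    (fun k F hF => cosTransform_mul_mem_unimodality (integrable_radialCap hpos hmono hn (hk k))
      (radiallyAntitone_radialCap hmono (hk k)) hF)
    (fun b hb => gaussian_mem_unimodality hb) hT hint)).2

theorem levyTail_sub_radialCap_le (hpos : ∀ r, 0 < r → 0 < ν r)
    (hmono : ∀ r₁ r₂, 0 < r₁ → r₁ ≤ r₂ → ν r₂ ≤ ν r₁)
    (hn : Integrable (fun z : E => min (‖z‖ ^ 2) 1 * ν ‖z‖)) {R L : ℝ} (hR : 0 < R)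
    (hL : 1 ≤ L) :
    levyTail (fun z : E => ν ‖z‖ - radialCap ν R z) (L * R ^ 2)
      ≤ 1 / L * levyTail (fun z : E => ν ‖z‖) (R ^ 2) := by
  have hL0 : 0 < L := by linarith
  have hcap := integrable_min_mul (integrable_radialCap (E := E) hpos hmono hn hR)
  have hsub : Integrable (fun z : E => min (‖z‖ ^ 2) 1 * (ν ‖z‖ - radialCap ν R z)) := by
    simp only [mul_sub]; exact hn.sub hcap
  rw [levyTail, levyTail, ← integral_const_mul]
  refine integral_mono (integrable_min_div_mul hsub (by positivity))
    ((integrable_min_div_mul hn (by positivity)).const_mul _) fun z => ?_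
  rcases eq_or_ne z 0 with rfl | hz
  · simp
  have hz0 := hpos _ (norm_pos_iff.mpr hz)
  rcases le_or_gt R ‖z‖ with h | h
  · simp only [radialCap_of_le h, sub_self, mul_zero]
    positivity
  · have h1 : ‖z‖ ^ 2 / R ^ 2 ≤ 1 := by
      rw [div_le_one (by positivity)]; gcongr
    simp only [min_eq_left h1]
    have h2 := radialCap_pos hpos hR z
    have h3 := radialCap_le hmono R hz
    calc min (‖z‖ ^ 2 / (L * R ^ 2)) 1 * (ν ‖z‖ - radialCap ν R z)
        ≤ ‖z‖ ^ 2 / (L * R ^ 2) * ν ‖z‖ :=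
          mul_le_mul (min_le_left _ _) (by linarith) (by linarith) (by positivity)
      _ = _ := by field_simp

theorem le_heatKernel (hpos : ∀ r, 0 < r → 0 < ν r)
    (hmono : ∀ r₁ r₂, 0 < r₁ → r₁ ≤ r₂ → ν r₂ ≤ ν r₁)
    (hn : Integrable (fun z : E => min (‖z‖ ^ 2) 1 * ν ‖z‖)) {T : ℝ} (hT : 0 ≤ T)
    (hint : Integrable (fun ξ : E => Real.exp (-(T * levyExponent (fun z => ν ‖z‖) ξ))))
    {R C : ℝ} (hR : 1 ≤ R) (hC : 1 ≤ C)
    (htail : T * levyTail (fun z : E => ν ‖z‖) (R ^ 2) ≤ C) (x : E) :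
    (2 * π) ^ Module.finrank ℝ E / 2 * Real.exp (-(T * ∫ z : E, radialCap ν R z)) *
        (T * ν (‖x‖ + (4 * C + 1) * R))
      ≤ cosTransform (fun ξ => Real.exp (-(T * levyExponent (fun z => ν ‖z‖) ξ))) x := by
  have hR0 : 0 < R := by linarith
  have hC0 : 0 < C := by linarith
  have hcap := integrable_radialCap (E := E) hpos hmono hn hR0
  set n : E → ℝ := fun z => ν ‖z‖ with hn_def
  set n₁ : E → ℝ := fun z => ν ‖z‖ - radialCap ν R z with hn₁_def
  set Q : E → ℝ := cosTransform (radialCap ν R) with hQ_def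
  set G : E → ℝ := fun ξ => Real.exp (-(T * levyExponent n₁ ξ)) with hG_def
  set lam := ∫ z : E, radialCap ν R z with hlam
  have hn₁ : Integrable (fun z : E => min (‖z‖ ^ 2) 1 * n₁ z) := by
    simp only [hn₁_def, mul_sub]; exact hn.sub (integrable_min_mul hcap)
  have h0 : ∀ z ≠ 0, 0 ≤ n₁ z := fun z hz => sub_nonneg.mpr (radialCap_le hmono R hz)
  have hexp : ∀ ξ, levyExponent n₁ ξ = levyExponent n ξ - (lam - Q ξ) := fun ξ => by
    rw [hn₁_def, levyExponent_sub hn (integrable_min_mul hcap),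
      levyExponent_eq_sub_cosTransform hcap]
  have hQb : ∀ ξ, |Q ξ| ≤ ∫ z : E, |radialCap ν R z| := abs_cosTransform_le hcap
  have hGF : ∀ ξ, G ξ = Real.exp (T * (lam - Q ξ)) * Real.exp (-(T * levyExponent n ξ)) := by
    intro ξ
    simp only [hG_def, hexp]
    rw [← Real.exp_add]; congr 1; ring
  have hG : Integrable G := by
    refine (hint.bdd_mul (c := Real.exp (T * (lam + ∫ z : E, |radialCap ν R z|)))
      (f := fun ξ => Real.exp (T * (lam - Q ξ))) ?_
      (Eventually.of_forall fun ξ => ?_)).congr (Eventually.of_forall fun ξ => (hGF ξ).symm)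
    · have := continuous_cosTransform hcap
      exact Continuous.aestronglyMeasurable (by fun_prop)
    · rw [Real.norm_eq_abs, abs_of_pos (Real.exp_pos _), Real.exp_le_exp]
      have := neg_le_of_abs_le (hQb ξ)
      gcongr
      linarith
  have hk : ∀ k : ℕ, (0 : ℝ) < 1 / (k + 1) := fun k => by positivity
  have hk1 : ∀ k : ℕ, 1 / ((k : ℝ) + 1) ≤ R := fun k =>
    ((div_le_one (by positivity)).mpr (by linarith [k.cast_nonneg (α := ℝ)])).trans hR
  have hm : ∀ k : ℕ, Integrable
      (fun z : E => radialCap ν (1 / ((k : ℝ) + 1)) z - radialCap ν R z) :=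
    fun k => (integrable_radialCap hpos hmono hn (hk k)).sub hcap
  have hm0 : ∀ (k : ℕ) (z : E), 0 ≤ radialCap ν (1 / ((k : ℝ) + 1)) z - radialCap ν R z :=
    fun k z => sub_nonneg.mpr (radialCap_anti hmono (hk k) (hk1 k) z)
  have hGcone : G ∈ dualCone (positivityKernels E) :=
    exp_levyExponent_mem_dualCone boundedFamily_positivityKernels hn₁ hm hm0
      (fun k z hz => sub_le_sub_right (radialCap_le hmono _ hz) _)
      (fun z hz => (tendsto_radialCap hz).sub_const _)
      (fun k F hF => cosTransform_mul_mem_positivity (hm k)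
        (fun z => by simp only [radialCap_neg]) (hm0 k) hF)
      (fun b hb => gaussian_mem_positivity hb) hT hG
  have hGpos := (mem_dualCone_positivityKernels.mp hGcone).2
  have hdiff := dualCone_exp_sub_mul boundedFamily_positivityKernels hQb
    (fun F hF => cosTransform_mul_mem_positivity hcap (radialCap_neg _)
      (fun z => (radialCap_pos hpos hR0 z).le) hF) hGcone hT
  have hdiffpos := (mem_dualCone_positivityKernels.mp hdiff).2 x
  have hQG : Integrable (fun ξ => Q ξ * G ξ) := integrable_cosTransform_mul hcap hG
  have hF_eq : ∀ ξ, Real.exp (-(T * levyExponent n ξ))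
      = Real.exp (-(T * lam)) * (((Real.exp (T * Q ξ) - T * Q ξ) * G ξ) + T * (Q ξ * G ξ)) := by
    intro ξ
    have : Real.exp (-(T * levyExponent n ξ))
        = Real.exp (-(T * lam)) * (Real.exp (T * Q ξ) * G ξ) := by
      simp only [hG_def, hexp]
      rw [← Real.exp_add, ← Real.exp_add]; congr 1; ring
    rw [this]; ring
  have hct : cosTransform (fun ξ => Real.exp (-(T * levyExponent n ξ))) x
      = Real.exp (-(T * lam)) * (cosTransform (fun ξ => (Real.exp (T * Q ξ) - T * Q ξ) * G ξ) x
        + T * cosTransform (fun ξ => Q ξ * G ξ) x) := by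
    have hcongr : ∀ ξ, Real.cos ⟪x, ξ⟫ * Real.exp (-(T * levyExponent n ξ))
        = Real.exp (-(T * lam)) * (Real.cos ⟪x, ξ⟫ * ((Real.exp (T * Q ξ) - T * Q ξ) * G ξ)
          + T * (Real.cos ⟪x, ξ⟫ * (Q ξ * G ξ))) := fun ξ => by rw [hF_eq]; ring
    simp only [cosTransform]
    rw [integral_congr_ae (Eventually.of_forall hcongr), integral_const_mul,
      integral_add (integrable_cos_inner_mul hdiff.1 x)
        ((integrable_cos_inner_mul hQG x).const_mul T), integral_const_mul]
  have hconv : cosTransform (fun ξ => Q ξ * G ξ) x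
      = ∫ y, radialCap ν R (x - y) * cosTransform G y := by
    rw [hQ_def, cosTransform_cosTransform_mul hcap hG (radialCap_neg _),
      ← integral_sub_left_eq_self _ volume x]
    simp
  set c := 1 / (4 * C * R ^ 2) with hc
  have hc0 : 0 < c := by positivity
  have hi1 := integrable_gaussian_mul_cosTransform hG hc0
  have hi2 := integrable_gaussian_mul_cosTransform hG (half_pos hc0)
  have hlow := le_integral_gaussian_mul_heatKernel hn₁ h0 hT hG hc0
  have hupp := integral_gaussian_mul_heatKernel_le hn₁ h0 hT hG (half_pos hc0)
  have htail₁ : T * levyTail n₁ (1 / c) ≤ 1 / 4 := by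
    have h := levyTail_sub_radialCap_le hpos hmono hn hR0 (L := 4 * C) (by linarith)
    rw [hc, one_div_one_div]
    calc T * levyTail n₁ (4 * C * R ^ 2) ≤ T * (1 / (4 * C) * levyTail n (R ^ 2)) := by gcongr
      _ = 1 / (4 * C) * (T * levyTail n (R ^ 2)) := by ring
      _ ≤ 1 / (4 * C) * C := by gcongr
      _ = 1 / 4 := by field_simp
  have hexp4 : Real.exp (-(2 * C)) ≤ 1 / 4 := by
    have h2 : Real.exp (-(2 * C)) ≤ Real.exp (-1) * Real.exp (-1) := by
      rw [← Real.exp_add, Real.exp_le_exp]; linarith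
    have h3 := Real.exp_neg_one_lt_half
    nlinarith [Real.exp_pos (-1)]
  have hNpos : 0 ≤ ν (‖x‖ + (4 * C + 1) * R) := (hpos _ (by positivity)).le
  have hmain : ∫ y, ν (‖x‖ + (4 * C + 1) * R) * (Real.exp (-c * ‖y‖ ^ 2) * cosTransform G y
      - Real.exp (-(2 * C)) * (Real.exp (-(c / 2) * ‖y‖ ^ 2) * cosTransform G y))
      ≤ ∫ y, radialCap ν R (x - y) * cosTransform G y := by
    refine integral_mono ((hi1.sub (hi2.const_mul _)).const_mul _) ?_ fun y => ?_
    · have := (integrable_mul_cosTransform_sub hcap hG x).comp_sub_left x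
      simpa using this
    have hmul : Real.exp (-c * ‖y‖ ^ 2)
        = Real.exp (-(c / 2) * ‖y‖ ^ 2) * Real.exp (-(c / 2) * ‖y‖ ^ 2) := by
      rw [← Real.exp_add]; congr 1; ring
    have heq : Real.exp (-c * ‖y‖ ^ 2) * cosTransform G y
        - Real.exp (-(2 * C)) * (Real.exp (-(c / 2) * ‖y‖ ^ 2) * cosTransform G y)
        = (Real.exp (-(c / 2) * ‖y‖ ^ 2) *
          (Real.exp (-(c / 2) * ‖y‖ ^ 2) - Real.exp (-(2 * C)))) * cosTransform G y := by
      rw [hmul]; ring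
    simp only [heq]
    rw [← mul_assoc]
    refine mul_le_mul_of_nonneg_right ?_ (hGpos y)
    have hcappos := radialCap_pos hpos hR0 (x - y)
    have he1 : Real.exp (-(c / 2) * ‖y‖ ^ 2) ≤ 1 := Real.exp_le_one_iff.mpr (by
      have : 0 ≤ (c / 2) * ‖y‖ ^ 2 := by positivity
      linarith)
    rcases le_or_gt ‖y‖ (4 * C * R) with hy | hy
    · have h1 : ν (‖x‖ + (4 * C + 1) * R) ≤ radialCap ν R (x - y) := by
        refine hmono _ _ (lt_max_of_lt_right hR0) (max_le ?_ ?_)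
        · have := norm_sub_le x y
          nlinarith
        · have := norm_nonneg x
          nlinarith [mul_pos hC0 hR0]
      refine (mul_le_of_le_one_right hNpos ?_).trans h1
      have := Real.exp_pos (-(2 * C))
      have := Real.exp_pos (-(c / 2) * ‖y‖ ^ 2)
      nlinarith
    · refine (mul_nonpos_of_nonneg_of_nonpos hNpos
        (mul_nonpos_of_nonneg_of_nonpos (Real.exp_pos _).le
          (sub_nonpos.mpr (Real.exp_le_exp.mpr ?_)))).trans hcappos.le
      have : 2 * C ≤ c / 2 * ‖y‖ ^ 2 := by
        calc 2 * C = c / 2 * (4 * C * R) ^ 2 := by rw [hc]; field_simp; norm_num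
          _ ≤ c / 2 * ‖y‖ ^ 2 := by gcongr
      linarith
  rw [integral_const_mul, integral_sub hi1 (hi2.const_mul _), integral_const_mul] at hmain
  have hpi : 0 < (2 * π) ^ Module.finrank ℝ E := by positivity
  have hhalf : (2 * π) ^ Module.finrank ℝ E / 2 ≤
      (∫ y, Real.exp (-c * ‖y‖ ^ 2) * cosTransform G y)
      - Real.exp (-(2 * C)) * ∫ y, Real.exp (-(c / 2) * ‖y‖ ^ 2) * cosTransform G y := by
    have h1 : (2 * π) ^ Module.finrank ℝ E * (3 / 4) ≤
        ∫ y, Real.exp (-c * ‖y‖ ^ 2) * cosTransform G y :=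
      le_trans (mul_le_mul_of_nonneg_left (by linarith) hpi.le) hlow
    have h2 : Real.exp (-(2 * C)) * ∫ y, Real.exp (-(c / 2) * ‖y‖ ^ 2) * cosTransform G y
        ≤ 1 / 4 * (2 * π) ^ Module.finrank ℝ E :=
      mul_le_mul hexp4 hupp
        (integral_nonneg fun y => mul_nonneg (Real.exp_pos _).le (hGpos y)) (by norm_num)
    linarith
  rw [hct, hconv]
  have hfin : ν (‖x‖ + (4 * C + 1) * R) * ((2 * π) ^ Module.finrank ℝ E / 2)
      ≤ ∫ y, radialCap ν R (x - y) * cosTransform G y :=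
    (mul_le_mul_of_nonneg_left hhalf hNpos).trans hmain
  calc (2 * π) ^ Module.finrank ℝ E / 2 * Real.exp (-(T * lam)) *
        (T * ν (‖x‖ + (4 * C + 1) * R))
      = Real.exp (-(T * lam)) * (0 + T *
          (ν (‖x‖ + (4 * C + 1) * R) * ((2 * π) ^ Module.finrank ℝ E / 2))) := by ring
    _ ≤ _ := by gcongr

end HeatKernelLower

section RegularVariation

theorem exists_halving_of_regularVariation {ν : ℝ → ℝ} (hpos : ∀ r, 0 < r → 0 < ν r) {κ γ : ℝ}
    (hκγ : γ < κ)
    (h : Tendsto (fun r : ℝ => ν (2 * r) / ν r) atTop (nhds ((2 : ℝ) ^ (-κ)))) :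
    ∃ r₀ : ℝ, 1 ≤ r₀ ∧ ∀ r, r₀ ≤ r → ν (2 * r) ≤ (2 : ℝ) ^ (-γ) * ν r := by
  have hlt : (2 : ℝ) ^ (-κ) < (2 : ℝ) ^ (-γ) :=
    Real.rpow_lt_rpow_of_exponent_lt one_lt_two (by linarith)
  obtain ⟨r₀, hr₀⟩ := eventually_atTop.mp (h.eventually_le_const hlt)
  refine ⟨max r₀ 1, le_max_right _ _, fun r hr => ?_⟩
  have hr1 : 0 < r := by linarith [le_max_right r₀ 1]
  exact (div_le_iff₀ (hpos r hr1)).mp (hr₀ r ((le_max_left _ _).trans hr))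

theorem le_rpow_mul_of_halving {ν : ℝ → ℝ} (hpos : ∀ r, 0 < r → 0 < ν r)
    (hmono : ∀ r₁ r₂, 0 < r₁ → r₁ ≤ r₂ → ν r₂ ≤ ν r₁) {γ r₀ : ℝ} (hγ : 0 ≤ γ) (hr₀ : 0 < r₀)
    (hhalf : ∀ r, r₀ ≤ r → ν (2 * r) ≤ (2 : ℝ) ^ (-γ) * ν r) {r r' : ℝ} (hr : r₀ ≤ r)
    (hrr : r ≤ r') : ν r' ≤ 2 ^ γ * (r' / r) ^ (-γ) * ν r := by
  have hr_pos : 0 < r := hr₀.trans_le hr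
  obtain ⟨k, hk1, hk2⟩ := exists_nat_pow_near ((one_le_div hr_pos).mpr hrr) one_lt_two
  have hpow : ∀ k : ℕ, ν (2 ^ k * r) ≤ ((2 : ℝ) ^ (-γ)) ^ k * ν r := by
    intro k
    induction k with
    | zero => simp
    | succ k ih =>
      have h1 : r₀ ≤ 2 ^ k * r :=
        hr.trans (le_mul_of_one_le_left hr_pos.le (one_le_pow₀ one_le_two))
      calc ν (2 ^ (k + 1) * r) = ν (2 * (2 ^ k * r)) := by congr 1; ring
        _ ≤ (2 : ℝ) ^ (-γ) * ν (2 ^ k * r) := hhalf _ h1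
        _ ≤ (2 : ℝ) ^ (-γ) * (((2 : ℝ) ^ (-γ)) ^ k * ν r) := by gcongr
        _ = _ := by ring
  refine (hmono (2 ^ k * r) r' (by positivity) ((le_div_iff₀ hr_pos).mp hk1)).trans
    ((hpow k).trans (mul_le_mul_of_nonneg_right ?_ (hpos r hr_pos).le))
  calc ((2 : ℝ) ^ (-γ)) ^ k = 2 ^ γ * ((2 : ℝ) ^ (k + 1)) ^ (-γ) := by
        rw [← Real.rpow_natCast, ← Real.rpow_natCast, ← Real.rpow_mul two_pos.le,
          ← Real.rpow_mul two_pos.le, ← Real.rpow_add two_pos]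
        congr 1; push_cast; ring
    _ ≤ 2 ^ γ * (r' / r) ^ (-γ) := by
        refine mul_le_mul_of_nonneg_left ?_ (by positivity)
        exact Real.rpow_le_rpow_of_nonpos (div_pos (hr_pos.trans_le hrr) hr_pos) hk2.le
          (by linarith)

theorem le_mul_rpow_of_le {ν : ℝ → ℝ} (hpos : ∀ r, 0 < r → 0 < ν r) {M κ : ℝ} (hM : 1 < M)
    (hA1 : ∀ r₁ r₂ : ℝ, 0 < r₁ → r₁ < r₂ → ν r₁ ≤ M * (r₂ / r₁) ^ κ * ν r₂) {r₁ r₂ : ℝ}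
    (h1 : 0 < r₁) (h12 : r₁ ≤ r₂) : ν r₁ ≤ M * (r₂ / r₁) ^ κ * ν r₂ := by
  rcases h12.eq_or_lt with rfl | h
  · rw [div_self h1.ne', Real.one_rpow, mul_one]
    exact le_mul_of_one_le_left (hpos _ h1).le hM.le
  · exact hA1 _ _ h1 h

variable {E : Type*} [NormedAddCommGroup E] [InnerProductSpace ℝ E] [FiniteDimensional ℝ E]
  [MeasurableSpace E] [BorelSpace E]

/-- The radial profile dominating the rescaled integrand of `levyTail`. -/
def tailProfile (d : ℕ) (β M γ : ℝ) (s : ℝ) : ℝ :=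
  if s ≤ 1 then M * s ^ (2 - d - β) else 2 ^ γ * s ^ (-γ)

theorem tailProfile_nonneg {d : ℕ} {β M γ : ℝ} (hM : 0 ≤ M) {s : ℝ} (hs : 0 ≤ s) :
    0 ≤ tailProfile d β M γ s := by
  unfold tailProfile
  split_ifs <;> positivity

theorem integrable_tailProfile_norm [Nontrivial E] {β M γ : ℝ} (hβ : β < 2)
    (hγ : Module.finrank ℝ E < γ) :
    Integrable (fun z : E => tailProfile (Module.finrank ℝ E) β M γ ‖z‖) := by
  have hd : 1 ≤ Module.finrank ℝ E := Module.finrank_pos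
  rw [integrable_fun_norm_addHaar, ← Set.Ioc_union_Ioi_eq_Ioi (zero_le_one (α := ℝ))]
  refine IntegrableOn.union ?_ ?_
  · have h := (intervalIntegral.intervalIntegrable_rpow' (a := 0) (b := 1)
      (show -1 < 1 - β by linarith)).const_mul M
    rw [intervalIntegrable_iff_integrableOn_Ioc_of_le zero_le_one] at h
    refine h.congr_fun (fun s hs => ?_) measurableSet_Ioc
    simp only [tailProfile, if_pos hs.2, smul_eq_mul]
    rw [mul_left_comm, ← Real.rpow_natCast, ← Real.rpow_add hs.1]
    congr 2
    push_cast [hd]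
    ring
  · have h := (integrableOn_Ioi_rpow_of_lt
      (show (Module.finrank ℝ E : ℝ) - 1 - γ < -1 by linarith) one_pos).const_mul (2 ^ γ)
    refine IntegrableOn.congr_fun h (fun s hs => ?_) measurableSet_Ioi
    have hs1 : 1 < s := hs
    simp only [tailProfile, if_neg hs1.not_ge, smul_eq_mul]
    rw [mul_left_comm, ← Real.rpow_natCast, ← Real.rpow_add (by linarith)]
    congr 2
    push_cast [hd]
    ring

theorem levyTail_le_of_regular [Nontrivial E] {ν : ℝ → ℝ} (hpos : ∀ r, 0 < r → 0 < ν r)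
    (hmono : ∀ r₁ r₂, 0 < r₁ → r₁ ≤ r₂ → ν r₂ ≤ ν r₁) {β M γ r₀ : ℝ} (hβ : β < 2) (hM : 1 < M)
    (hA1 : ∀ r₁ r₂ : ℝ, 0 < r₁ → r₁ < r₂ →
      ν r₁ ≤ M * (r₂ / r₁) ^ ((Module.finrank ℝ E : ℝ) + β) * ν r₂)
    (hγ : Module.finrank ℝ E < γ) (hr₀ : 0 < r₀)
    (hhalf : ∀ r, r₀ ≤ r → ν (2 * r) ≤ (2 : ℝ) ^ (-γ) * ν r) {u : ℝ} (hu : r₀ ≤ u) :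
    levyTail (fun z : E => ν ‖z‖) (u ^ 2)
      ≤ (∫ z : E, tailProfile (Module.finrank ℝ E) β M γ ‖z‖) *
        (u ^ Module.finrank ℝ E * ν u) := by
  have hu0 : 0 < u := hr₀.trans_le hu
  have hM0 : 0 < M := by linarith
  have hγ0 : 0 < γ := (Nat.cast_nonneg _).trans_lt hγ
  have hint := (integrable_tailProfile_norm (E := E) (M := M) hβ hγ)
  have hscale := Measure.integral_comp_inv_smul_of_nonneg (volume : Measure E)
    (fun z : E => tailProfile (Module.finrank ℝ E) β M γ ‖z‖) hu0.le
  have hint' := (hint.comp_smul (inv_ne_zero hu0.ne'))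
  have key : levyTail (fun z : E => ν ‖z‖) (u ^ 2)
      ≤ ∫ z : E, ν u * tailProfile (Module.finrank ℝ E) β M γ ‖u⁻¹ • z‖ := by
    refine integral_mono_of_nonneg
      (Eventually.of_forall (min_mul_nonneg (fun z hz => (hpos _ (norm_pos_iff.mpr hz)).le)
        (by positivity))) (hint'.const_mul _) (Eventually.of_forall fun z => ?_)
    rcases eq_or_ne z 0 with rfl | hz
    · simp only [norm_zero]
      have := tailProfile_nonneg (d := Module.finrank ℝ E) (β := β) (γ := γ) hM0.le
        (norm_nonneg (u⁻¹ • (0 : E)))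
      have := hpos u hu0
      simp only [ne_eq, OfNat.ofNat_ne_zero, not_false_eq_true, zero_pow, zero_div, zero_le_one,
        inf_of_le_left, zero_mul]
      positivity
    have hz0 : 0 < ‖z‖ := norm_pos_iff.mpr hz
    have hs : ‖u⁻¹ • z‖ = ‖z‖ / u := by
      rw [norm_smul, norm_inv, Real.norm_eq_abs, abs_of_pos hu0]; ring
    have hs0 : 0 < ‖z‖ / u := by positivity
    simp only [hs, tailProfile]
    split_ifs with h
    · have h1 := le_mul_rpow_of_le hpos hM hA1 hz0 ((div_le_one hu0).mp h)
      calc min (‖z‖ ^ 2 / u ^ 2) 1 * ν ‖z‖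
          ≤ (‖z‖ / u) ^ 2 * (M * (u / ‖z‖) ^ ((Module.finrank ℝ E : ℝ) + β) * ν u) := by
            rw [div_pow]
            exact mul_le_mul (min_le_left _ _) h1 (hpos _ hz0).le (by positivity)
        _ = ν u * (M * ((‖z‖ / u) ^ (2 : ℝ) *
              (‖z‖ / u) ^ (-((Module.finrank ℝ E : ℝ) + β)))) := by
            rw [Real.rpow_neg hs0.le, ← Real.inv_rpow hs0.le, inv_div, Real.rpow_two]
            ring
        _ = _ := by
            rw [← Real.rpow_add hs0]
            congr 3
            ring
    · have h1 := le_rpow_mul_of_halving hpos hmono hγ0.le hr₀ hhalf hu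
        ((one_lt_div hu0).mp (not_le.mp h)).le
      calc min (‖z‖ ^ 2 / u ^ 2) 1 * ν ‖z‖ ≤ 1 * ν ‖z‖ :=
            mul_le_mul_of_nonneg_right (min_le_right _ _) (hpos _ hz0).le
        _ ≤ _ := by linarith
  rw [integral_const_mul, hscale, smul_eq_mul] at key
  linarith

theorem integral_one_sub_cos_ball_add {ξ v : E} (hv : ⟪ξ, v⟫ = π) (u : ℝ) :
    (∫ z in Metric.ball (0 : E) u, (1 - Real.cos ⟪ξ, z⟫))
      + ∫ z in Metric.ball v u, (1 - Real.cos ⟪ξ, z⟫)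
      = 2 * volume.real (Metric.ball (0 : E) u) := by
  have hint : ∀ s : ℝ, IntegrableOn (fun z : E => 1 - s * Real.cos ⟪ξ, z⟫)
      (Metric.ball (0 : E) u) := fun s =>
    ((Continuous.locallyIntegrable (by fun_prop)).integrableOn_isCompact
      (isCompact_closedBall (0 : E) u)).mono_set Metric.ball_subset_closedBall
  have hshift : ∫ z in Metric.ball v u, (1 - Real.cos ⟪ξ, z⟫)
      = ∫ z in Metric.ball (0 : E) u, (1 - (-1) * Real.cos ⟪ξ, z⟫) := by
    rw [← integral_indicator Metric.isOpen_ball.measurableSet,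
      ← integral_indicator Metric.isOpen_ball.measurableSet,
      ← integral_add_right_eq_self _ v]
    congr 1
    ext w
    by_cases hw : w ∈ Metric.ball (0 : E) u
    · rw [Set.indicator_of_mem hw, Set.indicator_of_mem (by simpa using hw), inner_add_right, hv,
        Real.cos_add_pi]
      ring
    · rw [Set.indicator_of_notMem hw, Set.indicator_of_notMem (by simpa using hw)]
  have h1 := hint 1
  simp only [one_mul] at h1
  rw [hshift, ← integral_add h1 (hint (-1))]
  have : ∀ z : E, 1 - Real.cos ⟪ξ, z⟫ + (1 - -1 * Real.cos ⟪ξ, z⟫) = 2 := fun z => by ring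
  simp only [this, setIntegral_const, smul_eq_mul]
  ring

theorem le_levyExponent {ν : ℝ → ℝ} (hpos : ∀ r, 0 < r → 0 < ν r)
    (hmono : ∀ r₁ r₂, 0 < r₁ → r₁ ≤ r₂ → ν r₂ ≤ ν r₁)
    (hn : Integrable (fun z : E => min (‖z‖ ^ 2) 1 * ν ‖z‖)) {u : ℝ} (hu : 0 < u) {ξ : E}
    (hξ : 1 / u ≤ ‖ξ‖) :
    volume.real (Metric.ball (0 : E) 1) * (u ^ Module.finrank ℝ E * ν ((1 + π) * u))
      ≤ levyExponent (fun z => ν ‖z‖) ξ := by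
  have hξ0 : 0 < ‖ξ‖ := lt_of_lt_of_le (by positivity) hξ
  set v : E := (π / ‖ξ‖ ^ 2) • ξ with hv_def
  have hv : ⟪ξ, v⟫ = π := by
    rw [hv_def, real_inner_smul_right, real_inner_self_eq_norm_sq]
    field_simp
  have hvn : ‖v‖ ≤ π * u := by
    rw [hv_def, norm_smul, Real.norm_eq_abs, abs_of_pos (by positivity)]
    rw [div_le_iff₀ hu] at hξ
    rw [div_mul_eq_mul_div, div_le_iff₀ (by positivity)]
    nlinarith [mul_pos pi_pos hξ0, mul_le_mul_of_nonneg_left hξ (mul_pos pi_pos hξ0).le]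
  have hset : ∀ p : E, ‖p‖ ≤ π * u →
      ν ((1 + π) * u) * ∫ z in Metric.ball p u, (1 - Real.cos ⟪ξ, z⟫)
        ≤ levyExponent (fun z => ν ‖z‖) ξ := by
    intro p hp
    rw [← integral_indicator Metric.isOpen_ball.measurableSet, ← integral_const_mul]
    refine integral_mono_of_nonneg (Eventually.of_forall fun z => ?_)
      (integrable_one_sub_cos_mul hn ξ) (Eventually.of_forall fun z => ?_)
    · exact mul_nonneg (hpos _ (by positivity)).le
        (Set.indicator_nonneg (fun z _ => one_sub_cos_inner_nonneg ξ z) z)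
    · have hnn := one_sub_cos_mul_nonneg (n := fun z => ν ‖z‖)
        (fun z hz => (hpos _ (norm_pos_iff.mpr hz)).le) ξ z
      by_cases hz : z ∈ Metric.ball p u
      · simp only [Set.indicator_of_mem hz]
        rcases eq_or_ne z 0 with rfl | hz0
        · simp
        rw [mul_comm]
        refine mul_le_mul_of_nonneg_left (hmono _ _ (norm_pos_iff.mpr hz0) ?_)
          (one_sub_cos_inner_nonneg ξ z)
        rw [mem_ball_iff_norm] at hz
        have := norm_le_norm_add_norm_sub' z p
        linarith
      · simpa only [Set.indicator_of_notMem hz, mul_zero] using hnn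
  have h1 := hset 0 (by rw [norm_zero]; positivity)
  have h2 := hset v hvn
  have h3 := integral_one_sub_cos_ball_add hv u
  rw [Measure.real, Measure.addHaar_ball_of_pos _ _ hu, ENNReal.toReal_mul,
    ENNReal.toReal_ofReal (by positivity), ← Measure.real] at h3
  have h4 := congrArg (ν ((1 + π) * u) * ·) h3
  simp only [mul_add] at h4
  linarith

theorem levyExponent_le_levyTail {n : E → ℝ} (hn : Integrable (fun z => min (‖z‖ ^ 2) 1 * n z))
    (h0 : ∀ z ≠ 0, 0 ≤ n z) {u : ℝ} (hu : 0 < u) {ξ : E} (hξ : ‖ξ‖ ≤ 1 / u) :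
    levyExponent n ξ ≤ 2 * levyTail n (u ^ 2) := by
  rw [levyTail, ← integral_const_mul]
  refine integral_mono (integrable_one_sub_cos_mul hn ξ)
    ((integrable_min_div_mul hn (by positivity)).const_mul 2) fun z => ?_
  rcases eq_or_ne z 0 with rfl | hz
  · simp
  simp only
  rw [← mul_assoc]
  refine mul_le_mul_of_nonneg_right ?_ (h0 z hz)
  have h1 := Real.one_sub_sq_div_two_le_cos (x := ⟪ξ, z⟫)
  have h2 : ⟪ξ, z⟫ ^ 2 ≤ ‖z‖ ^ 2 / u ^ 2 := by
    rw [← sq_abs, ← div_pow]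
    refine pow_le_pow_left₀ (abs_nonneg _) ((abs_real_inner_le_norm ξ z).trans ?_) 2
    rw [div_eq_mul_one_div, mul_comm]
    gcongr
  have h3 := Real.neg_one_le_cos ⟪ξ, z⟫
  rcases min_choice (‖z‖ ^ 2 / u ^ 2) 1 with h | h <;> rw [h]
  · have : 0 ≤ ‖z‖ ^ 2 / u ^ 2 := by positivity
    linarith
  · linarith

end RegularVariation

section GeneralizedInverse

variable {d : ℕ} {ν : ℝ → ℝ}

theorem continuous_ψ
    (hn : Integrable (fun z : EuclideanSpace ℝ (Fin d) => min (‖z‖ ^ 2) 1 * ν ‖z‖)) :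
    Continuous (ψ d ν) := continuous_levyExponent hn

theorem bddAbove_ψ_image
    (hn : Integrable (fun z : EuclideanSpace ℝ (Fin d) => min (‖z‖ ^ 2) 1 * ν ‖z‖)) (r : ℝ) :
    BddAbove {y : ℝ | ∃ z : EuclideanSpace ℝ (Fin d), ‖z‖ ≤ r ∧ ψ d ν z = y} := by
  have h := ((isCompact_closedBall (0 : EuclideanSpace ℝ (Fin d)) r).image
    (continuous_ψ hn)).bddAbove
  refine h.mono ?_
  rintro y ⟨z, hz, rfl⟩
  exact ⟨z, by simpa using hz, rfl⟩

theorem ψ_le_ψstar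
    (hn : Integrable (fun z : EuclideanSpace ℝ (Fin d) => min (‖z‖ ^ 2) 1 * ν ‖z‖)) {r : ℝ}
    {z : EuclideanSpace ℝ (Fin d)} (hz : ‖z‖ ≤ r) : ψ d ν z ≤ ψstar d ν r :=
  le_csSup (bddAbove_ψ_image hn r) ⟨z, hz, rfl⟩

theorem ψstar_le {r B : ℝ} (hr : 0 ≤ r)
    (h : ∀ z : EuclideanSpace ℝ (Fin d), ‖z‖ ≤ r → ψ d ν z ≤ B) : ψstar d ν r ≤ B := by
  refine csSup_le ⟨_, 0, by simpa using hr, rfl⟩ ?_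
  rintro y ⟨z, hz, rfl⟩
  exact h z hz

theorem ψstar_mono
    (hn : Integrable (fun z : EuclideanSpace ℝ (Fin d) => min (‖z‖ ^ 2) 1 * ν ‖z‖)) {r s : ℝ}
    (hr : 0 ≤ r) (hrs : r ≤ s) : ψstar d ν r ≤ ψstar d ν s :=
  ψstar_le hr fun _ hz => ψ_le_ψstar hn (hz.trans hrs)

theorem ψstar_zero : ψstar d ν 0 = 0 := by
  have : {y : ℝ | ∃ z : EuclideanSpace ℝ (Fin d), ‖z‖ ≤ 0 ∧ ψ d ν z = y} = {0} := by
    ext y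
    simp only [norm_le_zero_iff, exists_eq_left, Set.mem_ofPred_eq, Set.mem_singleton_iff]
    rw [show ψ d ν 0 = 0 from levyExponent_zero _, eq_comm]
  rw [ψstar, this, csSup_singleton]

theorem exists_continuous_eq_ψstar
    (hn : Integrable (fun z : EuclideanSpace ℝ (Fin d) => min (‖z‖ ^ 2) 1 * ν ‖z‖)) :
    ∃ g : ℝ → ℝ, Continuous g ∧ ∀ r, 0 ≤ r → ψstar d ν r = g r := by
  refine ⟨fun r => sSup ((fun z => ψ d ν (r • z)) ''
    Metric.closedBall (0 : EuclideanSpace ℝ (Fin d)) 1), ?_, fun r hr => ?_⟩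
  · have hψ := continuous_ψ hn
    exact (isCompact_closedBall _ _).continuous_sSup
      (f := fun (r : ℝ) (z : EuclideanSpace ℝ (Fin d)) => ψ d ν (r • z))
      (hψ.comp (continuous_fst.smul continuous_snd))
  · unfold ψstar
    congr 1
    ext y
    constructor
    · rintro ⟨z, hz, rfl⟩
      rcases hr.eq_or_lt with rfl | hr
      · exact ⟨0, by simp, by rw [norm_le_zero_iff.mp hz]; simp⟩
      · refine ⟨r⁻¹ • z, ?_, by simp [smul_smul, hr.ne']⟩
        rw [mem_closedBall_zero_iff, norm_smul, norm_inv, Real.norm_eq_abs, abs_of_pos hr,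
          inv_mul_le_iff₀ hr]
        linarith
    · rintro ⟨z, hz, rfl⟩
      refine ⟨r • z, ?_, rfl⟩
      rw [norm_smul, Real.norm_eq_abs, abs_of_nonneg hr]
      exact mul_le_of_le_one_right hr (by simpa using hz)

theorem ψinv_spec
    (hn : Integrable (fun z : EuclideanSpace ℝ (Fin d) => min (‖z‖ ^ 2) 1 * ν ‖z‖)) {u ρ : ℝ}
    (hu : 0 < u) (hρ : 0 ≤ ρ) (huρ : u < ψstar d ν ρ) :
    0 < ψinv d ν u ∧ ψinv d ν u ≤ ρ ∧ ψstar d ν (ψinv d ν u) = u := by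
  obtain ⟨g, hg, hψg⟩ := exists_continuous_eq_ψstar hn
  set S := {r : ℝ | 0 ≤ r ∧ ψstar d ν r = u} with hS
  have hSg : S = Set.Ici 0 ∩ g ⁻¹' {u} := by
    ext r
    simp only [hS, Set.mem_ofPred_eq, Set.mem_inter_iff, Set.mem_Ici, Set.mem_preimage,
      Set.mem_singleton_iff]
    exact and_congr_right fun hr => by rw [hψg r hr]
  have hSclosed : IsClosed S := hSg ▸ isClosed_Ici.inter (isClosed_singleton.preimage hg)
  have hSle : ∀ r ∈ S, r ≤ ρ := fun r hr => by
    by_contra! h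
    exact absurd (ψstar_mono hn hρ h.le) (by rw [hr.2]; exact huρ.not_ge)
  have hSne : S.Nonempty := by
    obtain ⟨r, hr, hru⟩ := intermediate_value_Icc hρ hg.continuousOn
      (show u ∈ Set.Icc (g 0) (g ρ) by
        rw [← hψg 0 le_rfl, ← hψg ρ hρ, ψstar_zero]
        exact ⟨hu.le, huρ.le⟩)
    exact ⟨r, hr.1, by rw [hψg r hr.1, hru]⟩
  have hmem : ψinv d ν u ∈ S := hSclosed.csSup_mem hSne ⟨ρ, hSle⟩
  refine ⟨hmem.1.lt_of_ne' fun h => ?_, hSle _ hmem, hmem.2⟩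
  have := hmem.2
  rw [h, ψstar_zero] at this
  exact hu.ne this

theorem exists_one_lt_ψstar (hd : 1 ≤ d) {t₀ : ℝ} (ht₀ : 0 < t₀)
    (hn : Integrable (fun z : EuclideanSpace ℝ (Fin d) => min (‖z‖ ^ 2) 1 * ν ‖z‖))
    (hA3 : Integrable (fun ξ : EuclideanSpace ℝ (Fin d) => Real.exp (-(t₀ * ψ d ν ξ)))) :
    ∃ ρ, 0 ≤ ρ ∧ 1 < ψstar d ν ρ := by
  by_contra! h
  have hle : ∀ ξ, ψ d ν ξ ≤ 1 := fun ξ => (ψ_le_ψstar hn le_rfl).trans (h ‖ξ‖ (norm_nonneg ξ))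
  have hconst : Integrable (fun _ : EuclideanSpace ℝ (Fin d) => Real.exp (-t₀)) := by
    refine hA3.mono' aestronglyMeasurable_const (Eventually.of_forall fun ξ => ?_)
    rw [Real.norm_eq_abs, abs_of_pos (Real.exp_pos _), Real.exp_le_exp]
    nlinarith [hle ξ]
  have : Nonempty (Fin d) := ⟨⟨0, hd⟩⟩
  have : NoncompactSpace (EuclideanSpace ℝ (Fin d)) := NormedSpace.noncompactSpace ℝ _
  rcases integrable_const_iff.mp hconst with h0 | h0
  · exact (Real.exp_pos _).ne' h0
  · exact (measure_ne_top (μ := (volume : Measure (EuclideanSpace ℝ (Fin d)))) Set.univ)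
      (measure_univ_of_isAddLeftInvariant _)

end GeneralizedInverse

section RegularDensity

variable {E : Type*} [NormedAddCommGroup E] [InnerProductSpace ℝ E] [FiniteDimensional ℝ E]
  [MeasurableSpace E] [BorelSpace E]

variable (E) in
/-- A radial nonincreasing Lévy density on `E` with Matuszewska-type bounds: `ν` decays at most
like a power of order `d + β` everywhere, and at least like a power of order `γ > d` beyond `r₀`. -/
structure RegularDensity (ν : ℝ → ℝ) (β M γ r₀ : ℝ) : Prop where
  pos : ∀ r, 0 < r → 0 < ν r
  mono : ∀ r₁ r₂, 0 < r₁ → r₁ ≤ r₂ → ν r₂ ≤ ν r₁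
  integrable : Integrable (fun z : E => min (‖z‖ ^ 2) 1 * ν ‖z‖)
  lt_two : β < 2
  one_lt : 1 < M
  doubling : ∀ r₁ r₂ : ℝ, 0 < r₁ → r₁ < r₂ →
    ν r₁ ≤ M * (r₂ / r₁) ^ ((Module.finrank ℝ E : ℝ) + β) * ν r₂
  lt_order : Module.finrank ℝ E < γ
  one_le : 1 ≤ r₀
  halving : ∀ r, r₀ ≤ r → ν (2 * r) ≤ (2 : ℝ) ^ (-γ) * ν r

namespace RegularDensity

variable {ν : ℝ → ℝ} {β M γ r₀ : ℝ}

theorem le_mul (h : RegularDensity E ν β M γ r₀) {k r : ℝ} (hk : 1 ≤ k) (hr : 0 < r) :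
    ν r ≤ M * k ^ ((Module.finrank ℝ E : ℝ) + β) * ν (k * r) := by
  have := le_mul_rpow_of_le h.pos h.one_lt h.doubling hr (le_mul_of_one_le_left hr.le hk)
  rwa [mul_div_assoc, div_self hr.ne', mul_one] at this

theorem nonneg (h : RegularDensity E ν β M γ r₀) : ∀ z : E, z ≠ 0 → 0 ≤ ν ‖z‖ :=
  fun _ hz => (h.pos _ (norm_pos_iff.mpr hz)).le

theorem pow_mul_le (h : RegularDensity E ν β M γ r₀) {u R : ℝ} (hu : r₀ ≤ u) (huR : u ≤ R) :
    R ^ Module.finrank ℝ E * ν R * (R / u) ^ (γ - Module.finrank ℝ E)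
      ≤ 2 ^ γ * (u ^ Module.finrank ℝ E * ν u) := by
  have hr₀ : 0 < r₀ := by linarith [h.one_le]
  have hu0 : 0 < u := by linarith
  have hR0 : 0 < R := by linarith
  have hq : 0 < R / u := by positivity
  have hγ0 : 0 ≤ γ := (Nat.cast_nonneg _).trans h.lt_order.le
  have h1 := le_rpow_mul_of_halving h.pos h.mono hγ0 hr₀ h.halving hu huR
  have hR : R ^ Module.finrank ℝ E = (R / u) ^ Module.finrank ℝ E * u ^ Module.finrank ℝ E := by
    rw [← mul_pow, div_mul_cancel₀ _ hu0.ne']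
  have h2 : (R / u) ^ Module.finrank ℝ E * (R / u) ^ (-γ) * (R / u) ^ (γ - Module.finrank ℝ E)
      = 1 := by
    rw [← Real.rpow_natCast, ← Real.rpow_add hq, ← Real.rpow_add hq]
    ring_nf
    exact Real.rpow_zero _
  calc R ^ Module.finrank ℝ E * ν R * (R / u) ^ (γ - Module.finrank ℝ E)
      ≤ R ^ Module.finrank ℝ E * (2 ^ γ * (R / u) ^ (-γ) * ν u)
          * (R / u) ^ (γ - Module.finrank ℝ E) := by gcongr
    _ = 2 ^ γ * (u ^ Module.finrank ℝ E * ν u) * ((R / u) ^ Module.finrank ℝ E *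
          (R / u) ^ (-γ) * (R / u) ^ (γ - Module.finrank ℝ E)) := by rw [hR]; ring
    _ = _ := by rw [h2, mul_one]

theorem exists_levyTail_le [Nontrivial E] (h : RegularDensity E ν β M γ r₀) :
    ∃ C : ℝ, 0 < C ∧ ∀ u, r₀ ≤ u →
      levyTail (fun z : E => ν ‖z‖) (u ^ 2) ≤ C * (u ^ Module.finrank ℝ E * ν u) := by
  have hr₀ : 0 < r₀ := by linarith [h.one_le]
  refine ⟨1 + ∫ z : E, tailProfile (Module.finrank ℝ E) β M γ ‖z‖, ?_, fun u hu => ?_⟩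
  · have : 0 ≤ ∫ z : E, tailProfile (Module.finrank ℝ E) β M γ ‖z‖ :=
      integral_nonneg fun z => tailProfile_nonneg (by linarith [h.one_lt]) (norm_nonneg z)
    linarith
  · have hu0 : 0 < u := by linarith
    have := h.pos u hu0
    have h1 := levyTail_le_of_regular (E := E) h.pos h.mono h.lt_two h.one_lt h.doubling
      h.lt_order hr₀ h.halving hu
    have : 0 ≤ u ^ Module.finrank ℝ E * ν u := by positivity
    linarith

theorem exists_le_levyExponent (h : RegularDensity E ν β M γ r₀) :
    ∃ c : ℝ, 0 < c ∧ ∀ u, 0 < u → ∀ ξ : E, 1 / u ≤ ‖ξ‖ →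
      c * (u ^ Module.finrank ℝ E * ν u) ≤ levyExponent (fun z => ν ‖z‖) ξ := by
  have hω : 0 < volume.real (Metric.ball (0 : E) 1) :=
    ENNReal.toReal_pos (Metric.measure_ball_pos _ _ one_pos).ne' measure_ball_lt_top.ne
  have hM : 0 < M := by linarith [h.one_lt]
  refine ⟨volume.real (Metric.ball (0 : E) 1) /
    (M * (1 + π) ^ ((Module.finrank ℝ E : ℝ) + β)), by positivity, fun u hu ξ hξ => ?_⟩
  refine le_trans ?_ (le_levyExponent h.pos h.mono h.integrable hu hξ)
  have h1 := h.le_mul (k := 1 + π) (by linarith [pi_pos]) hu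
  calc _ ≤ volume.real (Metric.ball (0 : E) 1) /
        (M * (1 + π) ^ ((Module.finrank ℝ E : ℝ) + β)) * (u ^ Module.finrank ℝ E *
          (M * (1 + π) ^ ((Module.finrank ℝ E : ℝ) + β) * ν ((1 + π) * u))) := by gcongr
    _ = _ := by field_simp

end RegularDensity

theorem exists_rpow_mul_exp_neg_le {p c : ℝ} (hp : 0 ≤ p) (hc : 0 < c) :
    ∃ C : ℝ, 0 < C ∧ ∀ y, 0 ≤ y → y ^ p * Real.exp (-(c * y)) ≤ C := by
  obtain ⟨N, hN⟩ := exists_nat_ge p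
  refine ⟨1 + N.factorial / c ^ N, by positivity, fun y hy => ?_⟩
  have h1 : y ^ p ≤ 1 + y ^ N := by
    rcases le_total y 1 with h | h
    · have := Real.rpow_le_one hy h hp
      have : 0 ≤ y ^ N := by positivity
      linarith
    · have := Real.rpow_le_rpow_of_exponent_le h hN
      rw [Real.rpow_natCast] at this
      linarith
  have h2 : y ^ N * Real.exp (-(c * y)) ≤ N.factorial / c ^ N := by
    have := Real.pow_div_factorial_le_exp (c * y) (by positivity) N
    rw [Real.exp_neg, ← div_eq_mul_inv, div_le_div_iff₀ (Real.exp_pos _) (by positivity)]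
    rw [div_le_iff₀ (by positivity), mul_pow] at this
    linarith
  have h3 : Real.exp (-(c * y)) ≤ 1 := Real.exp_le_one_iff.mpr (by
    have : 0 ≤ c * y := by positivity
    linarith)
  calc y ^ p * Real.exp (-(c * y)) ≤ (1 + y ^ N) * Real.exp (-(c * y)) := by gcongr
    _ ≤ _ := by linarith

theorem exists_exp_neg_rpow_le {p η c : ℝ} (hp : 0 ≤ p) (hη : 0 < η) (hc : 0 < c) :
    ∃ C : ℝ, 0 < C ∧ ∀ s, 1 ≤ s → Real.exp (-(c * s ^ η)) ≤ C * (1 + s) ^ (-p) := by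
  obtain ⟨C, hC, h⟩ := exists_rpow_mul_exp_neg_le (p := p / η) (by positivity) hc
  refine ⟨2 ^ p * C, by positivity, fun s hs => ?_⟩
  have hs0 : 0 < s := by linarith
  have h1 := h (s ^ η) (by positivity)
  rw [← Real.rpow_mul hs0.le, mul_div_cancel₀ _ hη.ne'] at h1
  have h2 : (1 + s) ^ p ≤ 2 ^ p * s ^ p := by
    rw [← Real.mul_rpow two_pos.le hs0.le]
    exact Real.rpow_le_rpow (by positivity) (by linarith) hp
  rw [Real.rpow_neg (by positivity), ← div_eq_mul_inv, le_div_iff₀ (by positivity)]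
  calc Real.exp (-(c * s ^ η)) * (1 + s) ^ p ≤ Real.exp (-(c * s ^ η)) * (2 ^ p * s ^ p) := by
        gcongr
    _ = 2 ^ p * (s ^ p * Real.exp (-(c * s ^ η))) := by ring
    _ ≤ 2 ^ p * C := by gcongr

namespace RegularDensity

variable {ν : ℝ → ℝ} {β M γ r₀ : ℝ}

theorem integrable_exp (h : RegularDensity E ν β M γ r₀) {t₀ T : ℝ}
    (hA3 : Integrable (fun ξ : E => Real.exp (-(t₀ * levyExponent (fun z => ν ‖z‖) ξ))))
    (hT : t₀ ≤ T) :
    Integrable (fun ξ : E => Real.exp (-(T * levyExponent (fun z => ν ‖z‖) ξ))) := by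
  refine hA3.mono' (continuous_exp_neg_levyExponent h.integrable T).aestronglyMeasurable
    (Eventually.of_forall fun ξ => ?_)
  rw [Real.norm_eq_abs, abs_of_pos (Real.exp_pos _), Real.exp_le_exp, neg_le_neg_iff]
  exact mul_le_mul_of_nonneg_right hT (levyExponent_nonneg h.nonneg ξ)

/-- Frequencies below `1 / r₀`. -/
theorem exists_exp_le_of_norm_le (h : RegularDensity E ν β M γ r₀) (p : ℝ) (hp : 0 ≤ p) {C₂ : ℝ}
    (hC₂ : 0 < C₂) :
    ∃ C : ℝ, 0 < C ∧ ∀ T R : ℝ, 0 ≤ T → r₀ ≤ R →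
      1 ≤ C₂ * (T * (R ^ Module.finrank ℝ E * ν R)) → ∀ ξ : E, ‖ξ‖ ≤ 1 / r₀ →
        Real.exp (-(T * levyExponent (fun z => ν ‖z‖) ξ)) ≤ C * (1 + ‖R • ξ‖) ^ (-p) := by
  obtain ⟨c, hc, hlow⟩ := h.exists_le_levyExponent
  have hr₀ : 0 < r₀ := by linarith [h.one_le]
  obtain ⟨C, hC, hexp⟩ := exists_exp_neg_rpow_le hp
    (sub_pos.mpr h.lt_order) (c := c / (2 ^ γ * C₂)) (by positivity)
  refine ⟨C + 2 ^ p, by positivity, fun T R hT hR hTR ξ hξ => ?_⟩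
  have hR0 : 0 < R := by linarith
  have hRξ : ‖R • ξ‖ = R * ‖ξ‖ := by rw [norm_smul, Real.norm_eq_abs, abs_of_pos hR0]
  rcases le_or_gt 1 ‖R • ξ‖ with h1 | h1
  · have hξ0 : 0 < ‖ξ‖ := by
      rw [hRξ] at h1
      by_contra! h2
      nlinarith
    set u := 1 / ‖ξ‖ with hu
    have hu0 : 0 < u := by positivity
    have hur : r₀ ≤ u := by rw [hu, le_div_iff₀ hξ0]; rwa [le_div_iff₀ hr₀, mul_comm] at hξ
    have huR : u ≤ R := by rw [hu, div_le_iff₀ hξ0]; rwa [hRξ] at h1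
    have h2 := hlow u hu0 ξ (by rw [hu, one_div_one_div])
    have h3 := h.pow_mul_le hur huR
    have hRu : R / u = ‖R • ξ‖ := by rw [hRξ, hu]; field_simp
    rw [hRu] at h3
    have h4 : c / (2 ^ γ * C₂) * ‖R • ξ‖ ^ (γ - Module.finrank ℝ E)
        ≤ T * levyExponent (fun z => ν ‖z‖) ξ := by
      calc c / (2 ^ γ * C₂) * ‖R • ξ‖ ^ (γ - Module.finrank ℝ E)
          ≤ c / (2 ^ γ * C₂) * ‖R • ξ‖ ^ (γ - Module.finrank ℝ E)
            * (C₂ * (T * (R ^ Module.finrank ℝ E * ν R))) :=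
              le_mul_of_one_le_right (by positivity) hTR
        _ = c / 2 ^ γ * T * (R ^ Module.finrank ℝ E * ν R *
            ‖R • ξ‖ ^ (γ - Module.finrank ℝ E)) := by field_simp
        _ ≤ c / 2 ^ γ * T * (2 ^ γ * (u ^ Module.finrank ℝ E * ν u)) := by gcongr
        _ = T * (c * (u ^ Module.finrank ℝ E * ν u)) := by field_simp
        _ ≤ _ := by gcongr
    calc Real.exp (-(T * levyExponent (fun z => ν ‖z‖) ξ))
        ≤ Real.exp (-(c / (2 ^ γ * C₂) * ‖R • ξ‖ ^ (γ - Module.finrank ℝ E))) :=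
          Real.exp_le_exp.mpr (neg_le_neg h4)
      _ ≤ C * (1 + ‖R • ξ‖) ^ (-p) := hexp _ h1
      _ ≤ _ := by
          gcongr
          linarith [Real.rpow_pos_of_pos two_pos p]
  · have h5 : (1 : ℝ) ≤ 2 ^ p * (1 + ‖R • ξ‖) ^ (-p) := by
      rw [Real.rpow_neg (by positivity), ← div_eq_mul_inv, one_le_div (by positivity)]
      exact Real.rpow_le_rpow (by positivity) (by linarith) hp
    have h6 : 0 ≤ C * (1 + ‖R • ξ‖) ^ (-p) := by positivity
    have := exp_neg_levyExponent_le_one h.nonneg hT ξ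
    linarith

/-- Frequencies above `1 / r₀`. -/
theorem exists_exp_le_of_le_norm (h : RegularDensity E ν β M γ r₀) {t₀ C₂ : ℝ}
    (hC₂ : 0 < C₂) (ht₀ : 0 < t₀) :
    ∃ C : ℝ, 0 < C ∧ ∀ T R : ℝ, t₀ ≤ T → r₀ ≤ R →
      1 ≤ C₂ * (T * (R ^ Module.finrank ℝ E * ν R)) → ∀ ξ : E, 1 / r₀ ≤ ‖ξ‖ →
        Real.exp (-(T * levyExponent (fun z => ν ‖z‖) ξ)) ≤
          C * (R ^ Module.finrank ℝ E)⁻¹ *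
            Real.exp (-(t₀ * levyExponent (fun z => ν ‖z‖) ξ)) := by
  obtain ⟨c, hc, hlow⟩ := h.exists_le_levyExponent
  have hr₀ : 0 < r₀ := by linarith [h.one_le]
  have hη := sub_pos.mpr h.lt_order
  set d := Module.finrank ℝ E with hd
  set η := γ - d with hη_def
  have hν₀ := h.pos r₀ hr₀
  set c₀ := c * (r₀ ^ d * ν r₀) with hc₀_def
  have hc₀ : 0 < c₀ := by positivity
  obtain ⟨C, hC, hexp⟩ := exists_rpow_mul_exp_neg_le (p := d / η) (by positivity) hc₀
  set B := C₂ * (2 ^ γ * (r₀ ^ d * ν r₀)) with hB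
  have hB0 : 0 < B := by positivity
  refine ⟨r₀ ^ d * (B ^ (d / η) * C) * Real.exp (t₀ * c₀), by positivity,
    fun T R hT hR hTR ξ hξ => ?_⟩
  have hR0 : 0 < R := by linarith
  have hT0 : 0 < T := by linarith
  have hq : 0 < R / r₀ := by positivity
  have h1 := h.pow_mul_le le_rfl hR
  rw [← hd, ← hη_def] at h1
  have h2 : (R / r₀) ^ η ≤ B * T := by
    calc (R / r₀) ^ η ≤ (R / r₀) ^ η * (C₂ * (T * (R ^ d * ν R))) :=
          le_mul_of_one_le_right (by positivity) hTR
      _ = C₂ * T * (R ^ d * ν R * (R / r₀) ^ η) := by ring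
      _ ≤ C₂ * T * (2 ^ γ * (r₀ ^ d * ν r₀)) := by gcongr
      _ = B * T := by rw [hB]; ring
  have h3 : R ^ d ≤ r₀ ^ d * (B ^ (d / η) * T ^ (d / η)) := by
    have : (R / r₀) ^ d ≤ B ^ (d / η) * T ^ (d / η) := by
      rw [← Real.mul_rpow hB0.le hT0.le]
      calc (R / r₀) ^ d = ((R / r₀) ^ η) ^ (d / η) := by
            rw [← Real.rpow_mul hq.le, mul_div_cancel₀ _ hη.ne', Real.rpow_natCast]
        _ ≤ _ := Real.rpow_le_rpow (by positivity) h2 (by positivity)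
    rw [div_pow, div_le_iff₀ (by positivity)] at this
    linarith
  have h4 := hlow r₀ hr₀ ξ hξ
  have h5 := hexp T hT0.le
  have h6 : R ^ d * Real.exp (-(c₀ * T)) ≤ r₀ ^ d * (B ^ (d / η) * C) := by
    calc R ^ d * Real.exp (-(c₀ * T))
        ≤ r₀ ^ d * (B ^ (d / η) * T ^ (d / η)) * Real.exp (-(c₀ * T)) := by gcongr
      _ = r₀ ^ d * (B ^ (d / η) * (T ^ (d / η) * Real.exp (-(c₀ * T)))) := by ring
      _ ≤ _ := by gcongr
  calc Real.exp (-(T * levyExponent (fun z => ν ‖z‖) ξ))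
      ≤ Real.exp (-(c₀ * T) + t₀ * c₀ + -(t₀ * levyExponent (fun z => ν ‖z‖) ξ)) := by
        rw [Real.exp_le_exp]
        nlinarith [mul_le_mul_of_nonneg_left h4 (sub_nonneg.mpr hT)]
    _ = (R ^ d)⁻¹ * (R ^ d * Real.exp (-(c₀ * T))) * Real.exp (t₀ * c₀) *
          Real.exp (-(t₀ * levyExponent (fun z => ν ‖z‖) ξ)) := by
        rw [Real.exp_add, Real.exp_add, inv_mul_cancel_left₀ (by positivity)]
    _ ≤ (R ^ d)⁻¹ * (r₀ ^ d * (B ^ (d / η) * C)) * Real.exp (t₀ * c₀) *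
          Real.exp (-(t₀ * levyExponent (fun z => ν ‖z‖) ξ)) := by gcongr
    _ = _ := by ring

theorem exists_integral_exp_le (h : RegularDensity E ν β M γ r₀) {t₀ C₂ : ℝ}
    (hC₂ : 0 < C₂) (ht₀ : 0 < t₀)
    (hA3 : Integrable (fun ξ : E => Real.exp (-(t₀ * levyExponent (fun z => ν ‖z‖) ξ)))) :
    ∃ C : ℝ, 0 < C ∧ ∀ T R : ℝ, t₀ ≤ T → r₀ ≤ R →
      1 ≤ C₂ * (T * (R ^ Module.finrank ℝ E * ν R)) →
        ∫ ξ : E, Real.exp (-(T * levyExponent (fun z => ν ‖z‖) ξ))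
          ≤ C * (R ^ Module.finrank ℝ E)⁻¹ := by
  set p : ℝ := Module.finrank ℝ E + 1 with hp
  obtain ⟨C, hC, hlow⟩ := h.exists_exp_le_of_norm_le p (by positivity) hC₂
  obtain ⟨C', hC', hhigh⟩ := h.exists_exp_le_of_le_norm hC₂ ht₀
  have hI : Integrable (fun ξ : E => (1 + ‖ξ‖) ^ (-p)) := integrable_one_add_norm (by linarith)
  have hI0 : 0 ≤ ∫ ξ : E, (1 + ‖ξ‖) ^ (-p) := integral_nonneg fun ξ => by positivity
  have hJ0 : 0 ≤ ∫ ξ : E, Real.exp (-(t₀ * levyExponent (fun z => ν ‖z‖) ξ)) :=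
    integral_nonneg fun ξ => by positivity
  refine ⟨1 + C * (∫ ξ : E, (1 + ‖ξ‖) ^ (-p)) +
    C' * ∫ ξ : E, Real.exp (-(t₀ * levyExponent (fun z => ν ‖z‖) ξ)), by positivity,
    fun T R hT hR hTR => ?_⟩
  have hR0 : 0 < R := by linarith [h.one_le]
  have hIR := hI.comp_smul hR0.ne'
  have key : ∫ ξ : E, Real.exp (-(T * levyExponent (fun z => ν ‖z‖) ξ)) ≤
      ∫ ξ : E, (C * (1 + ‖R • ξ‖) ^ (-p) + C' * (R ^ Module.finrank ℝ E)⁻¹ *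
            Real.exp (-(t₀ * levyExponent (fun z => ν ‖z‖) ξ))) := by
    refine integral_mono (h.integrable_exp hA3 hT) ((hIR.const_mul C).add (hA3.const_mul _))
      fun ξ => ?_
    simp only
    rcases le_total ‖ξ‖ (1 / r₀) with h1 | h1
    · refine (hlow T R (ht₀.le.trans hT) hR hTR ξ h1).trans (le_add_of_nonneg_right ?_)
      positivity
    · refine (hhigh T R hT hR hTR ξ h1).trans (le_add_of_nonneg_left ?_)
      positivity
  rw [integral_add (hIR.const_mul C) (hA3.const_mul _), integral_const_mul, integral_const_mul,
    Measure.integral_comp_smul_of_nonneg volume (fun ξ : E => (1 + ‖ξ‖) ^ (-p)) R (hR := hR0.le),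
    smul_eq_mul] at key
  have : 0 ≤ (R ^ Module.finrank ℝ E)⁻¹ := by positivity
  linarith

end RegularDensity

end RegularDensity

section HeatKernelBounds

variable {E : Type*} [NormedAddCommGroup E] [InnerProductSpace ℝ E] [FiniteDimensional ℝ E]
  [MeasurableSpace E] [BorelSpace E]

namespace RegularDensity

variable {ν : ℝ → ℝ} {β M γ r₀ : ℝ}

theorem exists_heatKernel_le [Nontrivial E] (h : RegularDensity E ν β M γ r₀) {t₀ C₂ : ℝ}
    (hC₂ : 0 < C₂) (ht₀ : 0 < t₀)
    (hA3 : Integrable (fun ξ : E => Real.exp (-(t₀ * levyExponent (fun z => ν ‖z‖) ξ)))) :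
    ∃ C : ℝ, 0 < C ∧ ∀ T R : ℝ, t₀ ≤ T → r₀ ≤ R →
      1 ≤ C₂ * (T * (R ^ Module.finrank ℝ E * ν R)) → ∀ x : E, x ≠ 0 →
        cosTransform (fun ξ => Real.exp (-(T * levyExponent (fun z => ν ‖z‖) ξ))) x
          ≤ C * min (R ^ Module.finrank ℝ E)⁻¹ (T * ν ‖x‖) := by
  obtain ⟨C, hC, hI⟩ := h.exists_integral_exp_le hC₂ ht₀ hA3
  obtain ⟨C', hC', htail⟩ := h.exists_levyTail_le
  have hω : 0 < volume.real (Metric.ball (0 : E) 1) :=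
    ENNReal.toReal_pos (Metric.measure_ball_pos _ _ one_pos).ne' measure_ball_lt_top.ne
  set a := (Real.exp (-1 / 2) * (1 - Real.exp (-1 / 8))) *
    ((1 / 4) ^ Module.finrank ℝ E * volume.real (Metric.ball (0 : E) 1)) with ha_def
  have ha : 0 < a := by
    have : 0 < 1 - Real.exp (-1 / 8) := sub_pos.mpr (Real.exp_lt_one_iff.mpr (by norm_num))
    positivity
  refine ⟨C + C * C₂ + (2 * π) ^ Module.finrank ℝ E * C' / a, by positivity,
    fun T R hT hR hTR x hx => ?_⟩
  have hT0 : 0 < T := by linarith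
  have hR0 : 0 < R := by linarith [h.one_le]
  have hx0 : 0 < ‖x‖ := norm_pos_iff.mpr hx
  have hνx := h.pos _ hx0
  have hνR := h.pos _ hR0
  have hint := h.integrable_exp hA3 hT
  have h1 : cosTransform (fun ξ => Real.exp (-(T * levyExponent (fun z => ν ‖z‖) ξ))) x
      ≤ C * (R ^ Module.finrank ℝ E)⁻¹ := by
    refine (le_abs_self _).trans ((abs_cosTransform_le hint x).trans ?_)
    simp only [abs_of_pos (Real.exp_pos _)]
    exact hI T R hT hR hTR
  have hRd : 0 < R ^ Module.finrank ℝ E := by positivity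
  rw [mul_min_of_nonneg _ _ (by positivity), le_min_iff]
  refine ⟨h1.trans (mul_le_mul_of_nonneg_right ?_ (by positivity)), ?_⟩
  · rw [add_assoc]
    exact le_add_of_nonneg_right (by positivity)
  rcases le_or_gt R ‖x‖ with hxR | hxR
  · have h2 := heatKernel_le_levyTail h.integrable h.nonneg hT0.le hint
      (heatKernel_nonneg h.pos h.mono h.integrable hT0.le hint)
      (radiallyAntitone_heatKernel h.pos h.mono h.integrable hT0.le hint) hx
    have h3 := htail ‖x‖ (hR.trans hxR)
    have hxd : 0 < ‖x‖ ^ Module.finrank ℝ E := by positivity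
    have h4 : a * cosTransform (fun ξ => Real.exp (-(T * levyExponent (fun z => ν ‖z‖) ξ))) x
        ≤ (2 * π) ^ Module.finrank ℝ E * C' * (T * ν ‖x‖) := by
      refine le_of_mul_le_mul_left ?_ hxd
      calc _ = _ := ?_
        _ ≤ _ := h2
        _ ≤ (2 * π) ^ Module.finrank ℝ E *
            (T * (C' * (‖x‖ ^ Module.finrank ℝ E * ν ‖x‖))) := by gcongr
        _ = _ := by ring
      rw [ha_def, div_pow, div_pow, one_pow]
      ring
    calc _ ≤ (2 * π) ^ Module.finrank ℝ E * C' / a * (T * ν ‖x‖) := by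
          rw [div_mul_eq_mul_div, le_div_iff₀ ha, mul_comm]
          exact h4
      _ ≤ _ := by
          gcongr
          exact le_add_of_nonneg_left (by positivity)
  · have h2 : (R ^ Module.finrank ℝ E)⁻¹ ≤ C₂ * (T * ν ‖x‖) := by
      rw [inv_le_iff_one_le_mul₀ hRd]
      calc 1 ≤ C₂ * (T * (R ^ Module.finrank ℝ E * ν R)) := hTR
        _ ≤ C₂ * (T * (R ^ Module.finrank ℝ E * ν ‖x‖)) := by
            gcongr
            exact h.mono _ _ hx0 hxR.le
        _ = _ := by ring
    calc _ ≤ C * (C₂ * (T * ν ‖x‖)) := h1.trans (by gcongr)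
      _ = C * C₂ * (T * ν ‖x‖) := by ring
      _ ≤ _ := by
        gcongr
        rw [add_right_comm]
        exact le_add_of_nonneg_left (by positivity)

theorem exists_le_heatKernel [Nontrivial E] (h : RegularDensity E ν β M γ r₀) {t₀ C₁ C₂ : ℝ}
    (hC₂ : 0 < C₂) (ht₀ : 0 < t₀)
    (hA3 : Integrable (fun ξ : E => Real.exp (-(t₀ * levyExponent (fun z => ν ‖z‖) ξ)))) :
    ∃ c : ℝ, 0 < c ∧ ∀ T R : ℝ, t₀ ≤ T → r₀ ≤ R →
      T * (R ^ Module.finrank ℝ E * ν R) ≤ C₁ →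
      1 ≤ C₂ * (T * (R ^ Module.finrank ℝ E * ν R)) → ∀ x : E, x ≠ 0 →
        c * min (R ^ Module.finrank ℝ E)⁻¹ (T * ν ‖x‖) ≤
          cosTransform (fun ξ => Real.exp (-(T * levyExponent (fun z => ν ‖z‖) ξ))) x := by
  obtain ⟨C', hC', htail⟩ := h.exists_levyTail_le
  set C := max 1 (C' * C₁) with hC_def
  have hC1 : 1 ≤ C := le_max_left _ _
  have hM : 0 < M := by linarith [h.one_lt]
  set ω := volume.real (Metric.closedBall (0 : E) 1) with hω
  have hω0 : 0 ≤ ω := measureReal_nonneg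
  set b := (2 * π) ^ Module.finrank ℝ E / 2 * Real.exp (-(ω * C₁ + C)) with hb
  have hb0 : 0 < b := by positivity
  set k := M * (4 * C + 2) ^ ((Module.finrank ℝ E : ℝ) + β) with hk
  have hk0 : 0 < k := by positivity
  refine ⟨b / (k * (1 + C₂)), by positivity, fun T R hT hR hTR₁ hTR x hx => ?_⟩
  have hT0 : 0 < T := by linarith
  have hR1 : 1 ≤ R := h.one_le.trans hR
  have hR0 : 0 < R := by linarith
  have hx0 : 0 < ‖x‖ := norm_pos_iff.mpr hx
  have hνx := h.pos _ hx0
  have hνR := h.pos _ hR0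
  have hint := h.integrable_exp hA3 hT
  have hRd : 0 < R ^ Module.finrank ℝ E := by positivity
  have h1 : T * levyTail (fun z : E => ν ‖z‖) (R ^ 2) ≤ C := by
    calc _ ≤ T * (C' * (R ^ Module.finrank ℝ E * ν R)) := by gcongr; exact htail R hR
      _ = C' * (T * (R ^ Module.finrank ℝ E * ν R)) := by ring
      _ ≤ C' * C₁ := by gcongr
      _ ≤ C := le_max_right _ _
  have h2 := le_heatKernel h.pos h.mono h.integrable hT0.le hint hR1 hC1 h1 x
  have h3 : T * ∫ z : E, radialCap ν R z ≤ ω * C₁ + C := by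
    have h4 := integral_radialCap_le h.pos h.mono h.integrable hR0
    have h5 : volume.real (Metric.closedBall (0 : E) R) = R ^ Module.finrank ℝ E * ω := by
      rw [hω, Measure.real, Measure.addHaar_closedBall' _ _ hR0.le, ENNReal.toReal_mul,
        ENNReal.toReal_ofReal hRd.le, Measure.real]
    rw [h5] at h4
    calc _ ≤ T * (R ^ Module.finrank ℝ E * ω * ν R +
          levyTail (fun z : E => ν ‖z‖) (R ^ 2)) := by gcongr
      _ = ω * (T * (R ^ Module.finrank ℝ E * ν R)) +
          T * levyTail (fun z : E => ν ‖z‖) (R ^ 2) := by ring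
      _ ≤ _ := by gcongr
  set m := max ‖x‖ R with hm
  have hm0 : 0 < m := lt_max_of_lt_right hR0
  have h4 : ν m ≤ k * ν (‖x‖ + (4 * C + 1) * R) := by
    refine (h.le_mul (k := 4 * C + 2) (by linarith) hm0).trans ?_
    gcongr
    refine h.mono _ _ (by positivity) ?_
    have hmx : ‖x‖ ≤ m := le_max_left _ _
    have hmR : R ≤ m := le_max_right _ _
    have : (4 * C + 1) * R ≤ (4 * C + 1) * m := by gcongr
    linarith
  have h5 : min (R ^ Module.finrank ℝ E)⁻¹ (T * ν ‖x‖) ≤ (1 + C₂) * (T * ν m) := by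
    have hνm := h.pos m hm0
    rcases le_total R ‖x‖ with hxR | hxR
    · rw [hm, max_eq_left hxR]
      exact (min_le_right _ _).trans (le_mul_of_one_le_left (by positivity) (by linarith))
    · rw [hm, max_eq_right hxR]
      refine (min_le_left _ _).trans ?_
      rw [inv_le_iff_one_le_mul₀ hRd]
      have : 0 < R ^ Module.finrank ℝ E * (T * ν R) := by positivity
      calc 1 ≤ C₂ * (T * (R ^ Module.finrank ℝ E * ν R)) := hTR
        _ ≤ C₂ * (T * (R ^ Module.finrank ℝ E * ν R)) + R ^ Module.finrank ℝ E * (T * ν R) := by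
            linarith
        _ = _ := by ring
  calc b / (k * (1 + C₂)) * min (R ^ Module.finrank ℝ E)⁻¹ (T * ν ‖x‖)
      ≤ b / (k * (1 + C₂)) * ((1 + C₂) * (T * ν m)) := by gcongr
    _ ≤ b / (k * (1 + C₂)) * ((1 + C₂) * (T * (k * ν (‖x‖ + (4 * C + 1) * R)))) := by gcongr
    _ = b * (T * ν (‖x‖ + (4 * C + 1) * R)) := by field_simp
    _ ≤ (2 * π) ^ Module.finrank ℝ E / 2 * Real.exp (-(T * ∫ z : E, radialCap ν R z)) *
          (T * ν (‖x‖ + (4 * C + 1) * R)) := by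
        have := h.pos (‖x‖ + (4 * C + 1) * R) (by positivity)
        rw [hb]
        gcongr
    _ ≤ _ := h2

end RegularDensity

end HeatKernelBounds

section Rescaling

variable {d : ℕ} {ν : ℝ → ℝ} {β M γ r₀ : ℝ}

/-- For large `T`, the scale `R = 1 / ψ⁻¹(1 / T)` satisfies `T * (R ^ d * ν R) ≍ 1`. -/
theorem RegularDensity.exists_ψinv_bounds (hd : 1 ≤ d)
    (h : RegularDensity (EuclideanSpace ℝ (Fin d)) ν β M γ r₀) :
    ∃ T₁ C₁ C₂ : ℝ, 0 < T₁ ∧ 0 < C₂ ∧ ∀ T, T₁ ≤ T → 0 < ψinv d ν (1 / T) ∧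
      r₀ ≤ (ψinv d ν (1 / T))⁻¹ ∧
      T * ((ψinv d ν (1 / T))⁻¹ ^ d * ν (ψinv d ν (1 / T))⁻¹) ≤ C₁ ∧
      1 ≤ C₂ * (T * ((ψinv d ν (1 / T))⁻¹ ^ d * ν (ψinv d ν (1 / T))⁻¹)) := by
  have : Nontrivial (EuclideanSpace ℝ (Fin d)) :=
    Module.nontrivial_of_finrank_pos (R := ℝ) (by rw [finrank_euclideanSpace_fin]; exact hd)
  have hr₀ : 0 < r₀ := by linarith [h.one_le]
  have hν₀ := h.pos r₀ hr₀
  obtain ⟨c, hc, hlow⟩ := h.exists_le_levyExponent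
  obtain ⟨C, hC, htail⟩ := h.exists_levyTail_le
  simp only [finrank_euclideanSpace_fin] at hlow htail
  have hψ : ∀ u, 0 < u → c * (u ^ d * ν u) ≤ ψstar d ν (1 / u) := fun u hu => by
    obtain ⟨ξ, hξ⟩ := exists_norm_eq (EuclideanSpace ℝ (Fin d)) (c := 1 / u) (by positivity)
    exact (hlow u hu ξ hξ.ge).trans (ψ_le_ψstar h.integrable hξ.le)
  refine ⟨1 / (c * (r₀ ^ d * ν r₀)) + 1, 1 / c, 2 * C, by positivity, by positivity,
    fun T hT => ?_⟩
  have hw : 0 < 1 / (c * (r₀ ^ d * ν r₀)) := by positivity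
  have hT0 : 0 < T := by linarith
  have hlt : 1 / T < ψstar d ν (1 / r₀) := by
    refine lt_of_lt_of_le ?_ (hψ r₀ hr₀)
    rw [one_div_lt hT0 (by positivity)]
    linarith
  obtain ⟨ha0, ha1, ha2⟩ := ψinv_spec h.integrable (one_div_pos.mpr hT0) (by positivity) hlt
  set a := ψinv d ν (1 / T) with ha
  have hR : r₀ ≤ a⁻¹ := by
    rwa [le_inv_comm₀ hr₀ ha0, ← one_div]
  have hR0 : 0 < a⁻¹ := inv_pos.mpr ha0
  refine ⟨ha0, hR, ?_, ?_⟩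
  · have h1 := hψ a⁻¹ hR0
    rw [one_div, inv_inv, ha2, le_div_iff₀ hT0] at h1
    rw [le_div_iff₀ hc]
    linarith
  · have h1 : ψstar d ν a ≤ 2 * (C * (a⁻¹ ^ d * ν a⁻¹)) := ψstar_le ha0.le fun z hz =>
      (levyExponent_le_levyTail h.integrable h.nonneg hR0 (by rwa [one_div, inv_inv])).trans
        (mul_le_mul_of_nonneg_left (htail a⁻¹ hR) two_pos.le)
    rw [ha2, div_le_iff₀ hT0] at h1
    linarith

theorem pts_eq {s t : ℝ} (ha : 0 < ψinv d ν (1 / s)) (x : EuclideanSpace ℝ (Fin d)) :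
    pts d ν s t x = ((2 * π) ^ d)⁻¹ * ((ψinv d ν (1 / s) ^ d)⁻¹ *
      cosTransform (fun ξ => Real.exp (-(s * t * levyExponent (fun z => ν ‖z‖) ξ)))
        ((ψinv d ν (1 / s))⁻¹ • x)) := by
  have key := Measure.integral_comp_smul_of_nonneg
    (volume : Measure (EuclideanSpace ℝ (Fin d)))
    (fun ξ => Real.cos ⟪(ψinv d ν (1 / s))⁻¹ • x, ξ⟫ *
      Real.exp (-(s * t * levyExponent (fun z => ν ‖z‖) ξ))) (ψinv d ν (1 / s)) (hR := ha.le)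
  rw [smul_eq_mul, finrank_euclideanSpace_fin] at key
  rw [cosTransform, ← key, pts]
  congr 1
  refine integral_congr_ae (Eventually.of_forall fun ξ => ?_)
  simp only
  rw [real_inner_smul_left, real_inner_smul_right, inv_mul_cancel_left₀ ha.ne', real_inner_comm,
    ψs, mul_comm s t, mul_assoc]
  rfl

theorem min_ψinvs_mul_νs {s t : ℝ} (ha : 0 < ψinv d ν (1 / s))
    (x : EuclideanSpace ℝ (Fin d)) :
    min (ψinvs d ν s (1 / t) ^ d) (t * νs d ν s x) = (ψinv d ν (1 / s) ^ d)⁻¹ *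
      min (((ψinv d ν (1 / (s * t)))⁻¹ ^ d)⁻¹)
        (s * t * ν ‖(ψinv d ν (1 / s))⁻¹ • x‖) := by
  rw [mul_min_of_nonneg _ _ (by positivity), ψinvs, νs, div_div, mul_comm t s, div_pow, norm_smul,
    norm_inv, Real.norm_of_nonneg ha.le, inv_pow, inv_inv]
  congr 1
  · rw [div_eq_inv_mul]
  · rw [div_eq_inv_mul ‖x‖]
    ring

end Rescaling

theorem statement17
    (d : ℕ) (hd : 1 ≤ d) (ν : ℝ → ℝ)
    (hν_pos : ∀ r : ℝ, 0 < r → 0 < ν r)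
    (hν_mono : ∀ r₁ r₂ : ℝ, 0 < r₁ → r₁ ≤ r₂ → ν r₂ ≤ ν r₁)
    (hint : Integrable (fun z : EuclideanSpace ℝ (Fin d) => min (‖z‖ ^ 2) 1 * ν ‖z‖))
    (hninf : ¬ Integrable (fun z : EuclideanSpace ℝ (Fin d) => ν ‖z‖))
    (β M : ℝ) (hβ : β ∈ Set.Ioo (0:ℝ) 2) (hM : 1 < M)
    (hA1 : ∀ r₁ r₂ : ℝ, 0 < r₁ → r₁ < r₂ → ν r₁ ≤ M * (r₂ / r₁) ^ ((d:ℝ) + β) * ν r₂)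
    (α : ℝ) (hα : α ∈ Set.Ioo (0:ℝ) 2)
    (hA2 : ∀ lam : ℝ, 0 < lam →
      Tendsto (fun r : ℝ => ν (lam * r) / ν r) atTop (nhds (lam ^ (-(d:ℝ) - α))))
    (t₀ : ℝ) (ht₀ : 0 < t₀)
    (hA3 : Integrable (fun ξ : EuclideanSpace ℝ (Fin d) => Real.exp (-(t₀ * ψ d ν ξ))))
    (hnorm : ∀ ξ : EuclideanSpace ℝ (Fin d), ‖ξ‖ = 1 → ψ d ν ξ = 1)
:
    ∃ T₁ C : ℝ, t₀ ≤ T₁ ∧ 1 ≤ C ∧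
      ∀ s : ℝ, 1 ≤ s → ∀ t : ℝ, T₁ / s ≤ t →
        ∀ x : EuclideanSpace ℝ (Fin d), x ≠ 0 →
          C⁻¹ * min (ψinvs d ν s (1 / t) ^ d) (t * νs d ν s x) ≤ pts d ν s t x ∧
            pts d ν s t x ≤ C * min (ψinvs d ν s (1 / t) ^ d) (t * νs d ν s x) := by
  have : Nontrivial (EuclideanSpace ℝ (Fin d)) :=
    Module.nontrivial_of_finrank_pos (R := ℝ) (by rw [finrank_euclideanSpace_fin]; exact hd)
  obtain ⟨r₀, hr₀, hhalf⟩ := exists_halving_of_regularVariation hν_pos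
    (show (d : ℝ) + α / 2 < d + α by linarith [hα.1])
    (by rw [neg_add']; exact hA2 2 two_pos)
  have h : RegularDensity (EuclideanSpace ℝ (Fin d)) ν β M (d + α / 2) r₀ :=
    { pos := hν_pos
      mono := hν_mono
      integrable := hint
      lt_two := hβ.2
      one_lt := hM
      doubling := by rwa [finrank_euclideanSpace_fin]
      lt_order := by rw [finrank_euclideanSpace_fin]; linarith [hα.1]
      one_le := hr₀
      halving := hhalf }
  obtain ⟨T₁, C₁, C₂, hT₁, hC₂, hT⟩ := h.exists_ψinv_bounds hd
  obtain ⟨C, hC, hup⟩ := h.exists_heatKernel_le hC₂ ht₀ hA3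
  obtain ⟨c, hc, hlow⟩ := h.exists_le_heatKernel (C₁ := C₁) hC₂ ht₀ hA3
  obtain ⟨ρ, hρ, h1ρ⟩ := exists_one_lt_ψstar hd ht₀ hint hA3
  simp only [finrank_euclideanSpace_fin] at hup hlow
  set q := ((2 * π) ^ d)⁻¹ with hq
  have hq0 : 0 < q := by positivity
  refine ⟨max t₀ T₁, 1 + q * C + (q * c)⁻¹, le_max_left _ _, ?_, fun s hs t ht x hx => ?_⟩
  · rw [add_assoc]
    exact le_add_of_nonneg_right (by positivity)
  have hs0 : 0 < s := by linarith
  have hst : max t₀ T₁ ≤ s * t := by rwa [div_le_iff₀ hs0, mul_comm] at ht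
  have hst₀ : t₀ ≤ s * t := (le_max_left _ _).trans hst
  obtain ⟨ha, -, -⟩ := ψinv_spec hint (one_div_pos.mpr hs0) hρ
    (((div_le_one hs0).mpr hs).trans_lt h1ρ)
  obtain ⟨hb, hR, hw₁, hw₂⟩ := hT (s * t) ((le_max_right _ _).trans hst)
  have hx' : (ψinv d ν (1 / s))⁻¹ • x ≠ 0 := smul_ne_zero (inv_ne_zero ha.ne') hx
  have hνx := hν_pos _ (norm_pos_iff.mpr hx')
  have hst0 : 0 < s * t := by linarith
  have hA : 0 < (ψinv d ν (1 / s) ^ d)⁻¹ := by positivity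
  have hup' := hup _ _ hst₀ hR hw₂ _ hx'
  have hlow' := hlow _ _ hst₀ hR hw₁ hw₂ _ hx'
  have hm : 0 < min (((ψinv d ν (1 / (s * t)))⁻¹ ^ d)⁻¹)
      (s * t * ν ‖(ψinv d ν (1 / s))⁻¹ • x‖) := lt_min (by positivity) (by positivity)
  rw [pts_eq ha, min_ψinvs_mul_νs ha, ← hq]
  set m := min (((ψinv d ν (1 / (s * t)))⁻¹ ^ d)⁻¹)
      (s * t * ν ‖(ψinv d ν (1 / s))⁻¹ • x‖) with hm_def
  set A := (ψinv d ν (1 / s) ^ d)⁻¹ with hA_def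
  constructor
  · calc (1 + q * C + (q * c)⁻¹)⁻¹ * (A * m) ≤ q * c * (A * m) := by
          gcongr
          rw [inv_le_comm₀ (by positivity) (by positivity)]
          exact le_add_of_nonneg_left (by positivity)
      _ = q * (A * (c * m)) := by ring
      _ ≤ _ := by gcongr
  · calc _ ≤ q * (A * (C * m)) := by gcongr
      _ = q * C * (A * m) := by ring
      _ ≤ _ := by
        gcongr
        rw [add_right_comm]
        exact le_add_of_nonneg_left (by positivity)

end
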